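/- arXiv:1411.0624 — 11 statements merged into one kernel-verified Lean document; each statement's English description precedes it below -/
import Mathlib

section
/- Let n ≥ 3 with n ≡ 0 (mod 3), say n = 3k. Then the Stanley depth of the family P of cyclically independent subsets of [n] equals k = ⌈(n−1)/3⌉. (Equivalently, by Herzog–Vladoiu–Zheng, sdepth(S/J_n) = ⌈(n−1)/3⌉ for the edge ideal J_n of the n-cycle.) -/
/-- A subset `σ` of `[n] = {1,…,n}` is *cyclically independent* if it is an
independent set of the cycle graph `C_n`: it contains no pair `{i, i+1}` with
`1 ≤ i ≤ n-1`, and it does not contain both `1` and `n`. -/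
def CyclicIndep (n : ℕ) (σ : Finset ℕ) : Prop :=
  σ ⊆ Finset.Icc 1 n ∧
    (∀ i : ℕ, 1 ≤ i → i ≤ n - 1 → ¬(i ∈ σ ∧ i + 1 ∈ σ)) ∧
    ¬(1 ∈ σ ∧ n ∈ σ)

/-- A partition of a family `P` of subsets of `[n] = {1,…,n}` into finitely many
pairwise disjoint intervals `[F i, G i] = {σ : F i ⊆ σ ⊆ G i}`, each contained in
`P`, whose union is `P`.  (The interval `[F, G]` is `Finset.Icc F G`.) -/
structure IntervalPartition (n : ℕ) (P : Set (Finset ℕ)) where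
  r : ℕ
  F : Fin r → Finset ℕ
  G : Fin r → Finset ℕ
  le : ∀ i, F i ⊆ G i
  sub : ∀ i, G i ⊆ Finset.Icc 1 n
  disj : ∀ i j, i ≠ j → Disjoint (Finset.Icc (F i) (G i)) (Finset.Icc (F j) (G j))
  cover : ∀ σ : Finset ℕ, σ ∈ P ↔ ∃ i, σ ∈ Finset.Icc (F i) (G i)

/-- The sdepth of a partition `P = ⋃ i, [F i, G i]` is `min i, |G i|`; the Stanley
depth of `P` is the maximum of this quantity over all interval partitions of `P`,
i.e. the largest `k` such that `P` admits a partition all of whose upper ends `G i`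
have at least `k` elements. -/
noncomputable def stanleyDepth (n : ℕ) (P : Set (Finset ℕ)) : ℕ :=
  sSup {k : ℕ | ∃ part : IntervalPartition n P, ∀ i, k ≤ (part.G i).card}

/-- The family `P` admits a partition into intervals whose upper ends have at least `d` elements. -/
def HasIntervalPartition (d : ℕ) (P : Set (Finset ℕ)) : Prop :=
  ∃ T : Finset (Finset ℕ × Finset ℕ),
    (∀ p ∈ T, p.1 ⊆ p.2 ∧ d ≤ p.2.card) ∧
    (∀ p ∈ T, ∀ q ∈ T, ∀ σ, σ ∈ Finset.Icc p.1 p.2 → σ ∈ Finset.Icc q.1 q.2 → p = q) ∧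
    ∀ σ, σ ∈ P ↔ ∃ p ∈ T, σ ∈ Finset.Icc p.1 p.2

/-- Independent subsets of the path on the `m` vertices `a, …, a + m - 1`. -/
def pathIndep (a m : ℕ) : Set (Finset ℕ) :=
  {σ | (∀ x ∈ σ, a ≤ x ∧ x < a + m) ∧ ∀ i ∈ σ, i + 1 ∉ σ}

namespace HasIntervalPartition

theorem mono {d e : ℕ} {P : Set (Finset ℕ)} (h : HasIntervalPartition d P) (he : e ≤ d) :
    HasIntervalPartition e P := by
  obtain ⟨T, h1, h2, h3⟩ := h
  exact ⟨T, fun p hp => ⟨(h1 p hp).1, he.trans (h1 p hp).2⟩, h2, h3⟩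

theorem singleton_empty : HasIntervalPartition 0 {∅} :=
  ⟨{(∅, ∅)}, by simp, by simp, by simp⟩

theorem union {d : ℕ} {P Q : Set (Finset ℕ)} (hP : HasIntervalPartition d P)
    (hQ : HasIntervalPartition d Q) (hPQ : ∀ σ ∈ P, σ ∉ Q) :
    HasIntervalPartition d (P ∪ Q) := by
  obtain ⟨T, h1, h2, h3⟩ := hP
  obtain ⟨U, k1, k2, k3⟩ := hQ
  refine ⟨T ∪ U, fun p hp => ?_, fun p hp q hq σ hσp hσq => ?_, fun σ => ?_⟩
  · rcases Finset.mem_union.1 hp with hp | hp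
    exacts [h1 p hp, k1 p hp]
  · rcases Finset.mem_union.1 hp with hp | hp <;> rcases Finset.mem_union.1 hq with hq | hq
    · exact h2 p hp q hq σ hσp hσq
    · exact (hPQ σ ((h3 σ).2 ⟨p, hp, hσp⟩) ((k3 σ).2 ⟨q, hq, hσq⟩)).elim
    · exact (hPQ σ ((h3 σ).2 ⟨q, hq, hσq⟩) ((k3 σ).2 ⟨p, hp, hσp⟩)).elim
    · exact k2 p hp q hq σ hσp hσq
  · simp only [Set.mem_union, h3, k3, Finset.mem_union, or_and_right, exists_or]

/-- Transport of a partition along a map of intervals whose members are detected by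
erasing a vertex `a` not used by the original family. -/
theorem of_erase {d : ℕ} {P Q : Set (Finset ℕ)} {a : ℕ} (hP : HasIntervalPartition d P)
    (ha : ∀ σ ∈ P, a ∉ σ) (f : Finset ℕ → Finset ℕ) (c : Finset ℕ → Prop)
    (hf : ∀ F G, F ⊆ G → a ∉ G → f F ⊆ insert a G)
    (hc : ∀ F G σ, a ∉ F → a ∉ G →
      (σ ∈ Finset.Icc (f F) (insert a G) ↔ c σ ∧ σ.erase a ∈ Finset.Icc F G))
    (hQ : ∀ σ, σ ∈ Q ↔ c σ ∧ σ.erase a ∈ P) :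
    HasIntervalPartition (d + 1) Q := by
  obtain ⟨T, h1, h2, h3⟩ := hP
  have hG : ∀ p ∈ T, a ∉ p.2 := fun p hp =>
    ha _ ((h3 _).2 ⟨p, hp, Finset.mem_Icc.2 ⟨(h1 p hp).1, le_rfl⟩⟩)
  have hF : ∀ p ∈ T, a ∉ p.1 := fun p hp h => hG p hp ((h1 p hp).1 h)
  refine ⟨T.image fun p => (f p.1, insert a p.2), ?_, ?_, ?_⟩
  · simp only [Finset.forall_mem_image]
    intro p hp
    refine ⟨hf _ _ (h1 p hp).1 (hG p hp), ?_⟩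
    rw [Finset.card_insert_of_notMem (hG p hp)]
    exact Nat.succ_le_succ (h1 p hp).2
  · simp only [Finset.forall_mem_image]
    intro p hp q hq σ hσp hσq
    rw [h2 p hp q hq (σ.erase a) ((hc _ _ _ (hF p hp) (hG p hp)).1 hσp).2
      ((hc _ _ _ (hF q hq) (hG q hq)).1 hσq).2]
  · intro σ
    simp only [hQ, h3, Finset.exists_mem_image]
    constructor
    · rintro ⟨hσ, p, hp, h⟩
      exact ⟨p, hp, (hc _ _ _ (hF p hp) (hG p hp)).2 ⟨hσ, h⟩⟩
    · rintro ⟨p, hp, h⟩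
      have := (hc _ _ _ (hF p hp) (hG p hp)).1 h
      exact ⟨this.1, p, hp, this.2⟩

theorem adjoin_free {d : ℕ} {P : Set (Finset ℕ)} {a : ℕ} (hP : HasIntervalPartition d P)
    (ha : ∀ σ ∈ P, a ∉ σ) : HasIntervalPartition (d + 1) {σ | σ.erase a ∈ P} := by
  refine hP.of_erase ha id (fun _ => True) ?_ ?_ (by simp)
  · intro F G h _
    exact h.trans (Finset.subset_insert _ _)
  · intro F G σ hF hG
    simp only [Finset.mem_Icc, Finset.subset_iff, Finset.mem_insert,
      Finset.mem_erase, id]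
    grind

theorem adjoin_mem {d : ℕ} {P : Set (Finset ℕ)} {a : ℕ} (hP : HasIntervalPartition d P)
    (ha : ∀ σ ∈ P, a ∉ σ) : HasIntervalPartition (d + 1) {σ | a ∈ σ ∧ σ.erase a ∈ P} := by
  refine hP.of_erase ha (insert a) (fun σ => a ∈ σ) ?_ ?_ (by simp)
  · intro F G h _
    exact Finset.insert_subset_insert _ h
  · intro F G σ hF hG
    simp only [Finset.mem_Icc, Finset.subset_iff, Finset.mem_insert,
      Finset.mem_erase]
    grind

theorem pathIndep (m : ℕ) : ∀ a, HasIntervalPartition ((m + 2) / 3) (pathIndep a m) := by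
  induction m using Nat.strong_induction_on with
  | _ m ih =>
    intro a
    match m with
    | 0 =>
      convert singleton_empty using 1
      ext σ
      simp only [_root_.pathIndep, Set.mem_ofPred_eq, Set.mem_singleton_iff,
        Finset.eq_empty_iff_forall_notMem]
      grind
    | 1 =>
      convert (ih 0 (by omega) (a + 1)).adjoin_free (a := a) ?_ using 1
      · ext σ
        simp only [_root_.pathIndep, Set.mem_ofPred_eq, Finset.mem_erase]
        grind
      · intro σ hσ h
        have := (hσ.1 a h).1
        omega
    | m + 2 =>
      have h1 := (ih m (by omega) (a + 2)).adjoin_free (a := a) fun σ hσ h => by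
        have := (hσ.1 a h).1
        omega
      have h2 := (ih (m - 1) (by omega) (a + 3)).adjoin_mem (a := a + 1) fun σ hσ h => by
        have := (hσ.1 _ h).1
        omega
      convert (h1.mono (e := (m + 2 + 2) / 3) (by omega)).union
        (h2.mono (e := (m + 2 + 2) / 3) (by omega)) ?_ using 1
      · ext σ
        simp only [_root_.pathIndep, Set.mem_ofPred_eq, Finset.mem_erase, Set.mem_union]
        by_cases h : a + 1 ∈ σ
        · constructor
          · rintro ⟨hb, hi⟩
            refine Or.inr ⟨h, fun x hx => ?_, fun i hi' hj => hi i hi'.2 hj.2⟩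
            have hxa : x ≠ a := by
              rintro rfl
              exact hi x hx.2 h
            have hxa2 : x ≠ a + 2 := by
              rintro rfl
              exact hi (a + 1) h hx.2
            have := hb x hx.2
            omega
          · rintro (⟨hb, -⟩ | ⟨-, hb, hi⟩)
            · have := hb (a + 1) ⟨by omega, h⟩
              omega
            · refine ⟨fun x hx => ?_, fun i hi' hj => ?_⟩
              · have := hb x
                grind
              · have := hb i
                have := hb (i + 1)
                have := hi i
                grind
        · constructor
          · rintro ⟨hb, hi⟩
            refine Or.inl ⟨fun x hx => ?_, fun i hi' hj => hi i hi'.2 hj.2⟩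
            have hxa : x ≠ a + 1 := by
              rintro rfl
              exact h hx.2
            have := hb x hx.2
            omega
          · rintro (⟨hb, hi⟩ | ⟨h', -⟩)
            · refine ⟨fun x hx => ?_, fun i hi' hj => ?_⟩
              · have := hb x
                grind
              · have := hb (i + 1)
                have := hi i
                grind
            · exact (h h').elim
      · intro σ hσ h
        have := hσ.1 (a + 1) (Finset.mem_erase.2 ⟨by omega, h.1⟩)
        omega

theorem exists_intervalPartition {n d : ℕ} {P : Set (Finset ℕ)} (h : HasIntervalPartition d P)
    (hP : ∀ σ ∈ P, σ ⊆ Finset.Icc 1 n) :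
    ∃ part : IntervalPartition n P, ∀ i, d ≤ (part.G i).card := by
  obtain ⟨T, h1, h2, h3⟩ := h
  let e := T.equivFin
  refine ⟨⟨T.card, fun i => (e.symm i).1.1, fun i => (e.symm i).1.2,
    fun i => (h1 _ (e.symm i).2).1, fun i => hP _ ((h3 _).2 ⟨_, (e.symm i).2,
      Finset.mem_Icc.2 ⟨(h1 _ (e.symm i).2).1, le_rfl⟩⟩), fun i j hij => ?_, fun σ => ?_⟩,
    fun i => (h1 _ (e.symm i).2).2⟩
  · refine Finset.disjoint_left.2 fun σ hi hj => hij ?_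
    exact e.symm.injective (Subtype.ext (h2 _ (e.symm i).2 _ (e.symm j).2 σ hi hj))
  · rw [h3]
    constructor
    · rintro ⟨p, hp, h⟩
      exact ⟨e ⟨p, hp⟩, by simpa using h⟩
    · rintro ⟨i, h⟩
      exact ⟨_, (e.symm i).2, h⟩

theorem cyclicIndep {k : ℕ} (hk : 1 ≤ k) :
    HasIntervalPartition k {σ | CyclicIndep (3 * k) σ} := by
  have h1 := pathIndep (3 * k - 1) 1
  have h2 := (pathIndep (3 * k - 3) 2).adjoin_mem (a := 3 * k) fun σ hσ h => by
    have := (hσ.1 _ h).2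
    omega
  convert (h1.mono (e := k) (by omega)).union (h2.mono (e := k) (by omega)) ?_ using 1
  · ext σ
    simp only [CyclicIndep, _root_.pathIndep, Set.mem_ofPred_eq, Finset.mem_erase, Set.mem_union,
      Finset.subset_iff, Finset.mem_Icc]
    by_cases h : 3 * k ∈ σ
    · constructor
      · rintro ⟨h1, h2, h3⟩
        refine Or.inr ⟨h, fun x hx => ?_, fun i hi hj => ?_⟩
        · have := h1 hx.2
          have hx1 : x ≠ 1 := by grind
          have := h2 x
          grind
        · have := h1 hi.2
          exact h2 i this.1 (by omega) ⟨hi.2, hj.2⟩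
      · rintro (⟨h1, h2⟩ | ⟨-, h1, h2⟩)
        · have := h1 _ h
          omega
        · refine ⟨fun x hx => ?_, fun i hi hin hj => ?_, fun h3 => ?_⟩
          · have := h1 x
            grind
          · have := h1 i
            have := h2 i
            grind
          · have := h1 1
            grind
    · constructor
      · rintro ⟨h1, h2, h3⟩
        refine Or.inl ⟨fun x hx => ?_, fun i hi hj => ?_⟩
        · have := h1 hx
          grind
        · have := h1 hi
          have := h1 hj
          exact h2 i (by omega) (by omega) ⟨hi, hj⟩
      · rintro (⟨h1, h2⟩ | ⟨h1, -⟩)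
        · refine ⟨fun x hx => ?_, fun i hi hin hj => h2 i hj.1 hj.2, fun h3 => h h3.2⟩
          have := h1 x hx
          omega
        · exact (h h1).elim
  · intro σ hσ h
    have := hσ.1 _ h.1
    omega

end HasIntervalPartition

/-- The set `{1, 4, …, 3k - 2}` is a maximal cyclically independent subset of `[3k]`. -/
theorem eq_of_cyclicIndep_of_subset {k : ℕ} {σ : Finset ℕ} (hσ : CyclicIndep (3 * k) σ)
    (h : (Finset.range k).image (fun j => 3 * j + 1) ⊆ σ) :
    σ = (Finset.range k).image (fun j => 3 * j + 1) := by
  refine Finset.Subset.antisymm (fun x hx => ?_) h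
  have hmem : ∀ j < k, 3 * j + 1 ∈ σ := fun j hj =>
    h (Finset.mem_image_of_mem _ (Finset.mem_range.2 hj))
  obtain ⟨h1, h2, h3⟩ := hσ
  have hx' := Finset.mem_Icc.1 (h1 hx)
  obtain ⟨j, hj | hj | hj⟩ : ∃ j, x = 3 * j + 1 ∨ x = 3 * j + 2 ∨ x = 3 * j + 3 :=
    ⟨(x - 1) / 3, by omega⟩
  · exact Finset.mem_image.2 ⟨j, Finset.mem_range.2 (by omega), hj.symm⟩
  · subst hj
    exact (h2 (3 * j + 1) (by omega) (by omega) ⟨hmem j (by omega), hx⟩).elim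
  · subst hj
    rcases Nat.lt_or_ge (j + 1) k with hjk | hjk
    · exact (h2 (3 * j + 3) (by omega) (by omega) ⟨hx, hmem (j + 1) hjk⟩).elim
    · obtain rfl : k = j + 1 := by omega
      exact (h3 ⟨hmem 0 (by omega), hx⟩).elim

theorem cyclicIndep_image_range (k : ℕ) :
    CyclicIndep (3 * k) ((Finset.range k).image (fun j => 3 * j + 1)) := by
  simp only [CyclicIndep, Finset.subset_iff, Finset.mem_image, Finset.mem_range, Finset.mem_Icc]
  refine ⟨?_, ?_, ?_⟩
  · rintro x ⟨j, hj, rfl⟩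
    omega
  · rintro i - - ⟨⟨j, hj, rfl⟩, l, hl, h⟩
    omega
  · rintro ⟨-, l, hl, h⟩
    omega

/-- For `n ≥ 3` with `n = 3k`, the Stanley depth of the family of
cyclically independent subsets of `[n]` equals `k = ⌈(n-1)/3⌉`. -/
theorem stmt_0 (n k : ℕ) (hn : 3 ≤ n) (hk : n = 3 * k) :
    stanleyDepth n {σ : Finset ℕ | CyclicIndep n σ} = k := by
  subst hk
  refine IsGreatest.csSup_eq ⟨?_, ?_⟩
  · exact (HasIntervalPartition.cyclicIndep (by omega)).exists_intervalPartition fun σ hσ => hσ.1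
  · rintro d ⟨part, hd⟩
    obtain ⟨i, hi⟩ := (part.cover _).1 (cyclicIndep_image_range k)
    have hG : CyclicIndep (3 * k) (part.G i) :=
      (part.cover _).2 ⟨i, Finset.mem_Icc.2 ⟨part.le i, le_rfl⟩⟩
    have hcard := hd i
    rw [eq_of_cyclicIndep_of_subset hG (Finset.mem_Icc.1 hi).2] at hcard
    exact hcard.trans (Finset.card_image_le.trans (Finset.card_range k).le)
end

section
/- Let n ≥ 5 with n ≡ 2 (mod 3), say n = 3k+2. Then the Stanley depth of the family P of cyclically independent subsets of [n] equals k+1 = ⌈(n−1)/3⌉. -/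
/-- `P` splits into disjoint intervals with upper ends of size at least `d`: the functions
`f` and `g` send each member of `P` to the ends of the interval containing it. -/
def HasIntervalDecomposition (d : ℕ) (P : Set (Finset ℕ)) : Prop :=
  ∃ f g : Finset ℕ → Finset ℕ, ∀ σ ∈ P, f σ ⊆ σ ∧ σ ⊆ g σ ∧ d ≤ (g σ).card ∧
    ∀ τ, f σ ⊆ τ → τ ⊆ g σ → τ ∈ P ∧ f τ = f σ ∧ g τ = g σ

namespace HasIntervalDecomposition

variable {d e v : ℕ} {P Q : Set (Finset ℕ)}

theorem mono (h : HasIntervalDecomposition d P) (hed : e ≤ d) :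
    HasIntervalDecomposition e P := by
  obtain ⟨f, g, h⟩ := h
  exact ⟨f, g, fun σ hσ => ⟨(h σ hσ).1, (h σ hσ).2.1, hed.trans (h σ hσ).2.2.1,
    (h σ hσ).2.2.2⟩⟩

theorem union (hP : HasIntervalDecomposition d P) (hQ : HasIntervalDecomposition d Q)
    (hPQ : Disjoint P Q) : HasIntervalDecomposition d (P ∪ Q) := by
  classical
  obtain ⟨f, g, h⟩ := hP
  obtain ⟨f', g', h'⟩ := hQ
  have hdis : ∀ σ ∈ Q, σ ∉ P := fun σ hQ hP => Set.disjoint_left.1 hPQ hP hQ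
  refine ⟨fun σ => if σ ∈ P then f σ else f' σ, fun σ => if σ ∈ P then g σ else g' σ, ?_⟩
  rintro σ (hσ | hσ)
  · obtain ⟨h1, h2, h3, h4⟩ := h σ hσ
    simp only [if_pos hσ]
    refine ⟨h1, h2, h3, fun τ hf hg => ?_⟩
    obtain ⟨h5, h6, h7⟩ := h4 τ hf hg
    simp only [if_pos h5]
    exact ⟨Or.inl h5, h6, h7⟩
  · obtain ⟨h1, h2, h3, h4⟩ := h' σ hσ
    simp only [if_neg (hdis σ hσ)]
    refine ⟨h1, h2, h3, fun τ hf hg => ?_⟩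
    obtain ⟨h5, h6, h7⟩ := h4 τ hf hg
    simp only [if_neg (hdis τ h5)]
    exact ⟨Or.inr h5, h6, h7⟩

theorem insert (h : HasIntervalDecomposition d P) (hv : ∀ σ ∈ P, v ∉ σ) :
    HasIntervalDecomposition (d + 1) {σ | v ∈ σ ∧ σ.erase v ∈ P} := by
  obtain ⟨f, g, h⟩ := h
  refine ⟨fun σ => Insert.insert v (f (σ.erase v)), fun σ => Insert.insert v (g (σ.erase v)), ?_⟩
  rintro σ ⟨hvσ, hσ⟩
  obtain ⟨h1, h2, h3, h4⟩ := h _ hσ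
  have hg := hv _ (h4 _ (h1.trans h2) subset_rfl).1
  have hf := fun hf => hg (h2 (h1 hf))
  refine ⟨by grind, by grind, by simpa [Finset.card_insert_of_notMem hg] using h3, ?_⟩
  intro τ h5 h6
  obtain ⟨h7, h8, h9⟩ := h4 (τ.erase v) (by grind) (by grind)
  exact ⟨⟨by grind, h7⟩, by simp only [h8], by simp only [h9]⟩

theorem cone (h : HasIntervalDecomposition d P) (hv : ∀ σ ∈ P, v ∉ σ) :
    HasIntervalDecomposition (d + 1) {σ | σ.erase v ∈ P} := by
  obtain ⟨f, g, h⟩ := h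
  refine ⟨fun σ => f (σ.erase v), fun σ => Insert.insert v (g (σ.erase v)), ?_⟩
  intro σ hσ
  obtain ⟨h1, h2, h3, h4⟩ := h _ hσ
  have hg := hv _ (h4 _ (h1.trans h2) subset_rfl).1
  have hf := fun hf => hg (h2 (h1 hf))
  refine ⟨by grind, by grind, by simpa [Finset.card_insert_of_notMem hg] using h3, ?_⟩
  intro τ h5 h6
  obtain ⟨h7, h8, h9⟩ := h4 (τ.erase v) (by grind) (by grind)
  exact ⟨h7, h8, by simp only [h9]⟩

theorem exists_intervalPartition {n : ℕ} (h : HasIntervalDecomposition d P)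
    (hP : ∀ σ ∈ P, σ ⊆ Finset.Icc 1 n) :
    ∃ part : IntervalPartition n P, ∀ i, d ≤ (part.G i).card := by
  classical
  obtain ⟨f, g, h⟩ := h
  let S : Finset (Finset ℕ × Finset ℕ) :=
    ((Finset.Icc 1 n).powerset.filter (· ∈ P)).image fun σ => (f σ, g σ)
  have hS : ∀ p : S, ∃ σ ∈ P, f σ = p.1.1 ∧ g σ = p.1.2 := by
    rintro ⟨p, hp⟩
    obtain ⟨σ, hσ, rfl⟩ := Finset.mem_image.1 hp
    exact ⟨σ, (Finset.mem_filter.1 hσ).2, rfl, rfl⟩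
  have hmem : ∀ σ ∈ P, (f σ, g σ) ∈ S := fun σ hσ =>
    Finset.mem_image_of_mem _ (Finset.mem_filter.2 ⟨Finset.mem_powerset.2 (hP σ hσ), hσ⟩)
  have hIcc : ∀ (p : S) (τ), τ ∈ Finset.Icc p.1.1 p.1.2 → τ ∈ P ∧ (f τ, g τ) = p.1 := by
    intro p τ hτ
    obtain ⟨σ, hσ, hf, hg⟩ := hS p
    rw [← hf, ← hg, Finset.mem_Icc] at hτ
    obtain ⟨h1, h2, h3⟩ := (h σ hσ).2.2.2 τ hτ.1 hτ.2
    exact ⟨h1, Prod.ext (h2.trans hf) (h3.trans hg)⟩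
  have hle : ∀ p : S, p.1.1 ⊆ p.1.2 := fun p => by
    obtain ⟨σ, hσ, hf, hg⟩ := hS p
    exact hf ▸ hg ▸ (h σ hσ).1.trans (h σ hσ).2.1
  refine ⟨⟨S.card, fun i => (S.equivFin.symm i).1.1, fun i => (S.equivFin.symm i).1.2,
    fun i => hle _, fun i => ?_, fun i j hij => ?_, fun σ => ⟨fun hσ => ?_, ?_⟩⟩, fun i => ?_⟩
  · exact hP _ (hIcc _ _ (Finset.mem_Icc.2 ⟨hle _, le_rfl⟩)).1
  · refine Finset.disjoint_left.2 fun τ hi hj => hij ?_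
    exact S.equivFin.symm.injective
      (Subtype.ext ((hIcc _ _ hi).2.symm.trans (hIcc _ _ hj).2))
  · refine ⟨S.equivFin ⟨_, hmem σ hσ⟩, ?_⟩
    simpa using ⟨(h σ hσ).1, (h σ hσ).2.1⟩
  · rintro ⟨i, hi⟩
    exact (hIcc _ _ hi).1
  · obtain ⟨σ, hσ, -, hg⟩ := hS (S.equivFin.symm i)
    exact (h σ hσ).2.2.1.trans_eq (congrArg Finset.card hg)

end HasIntervalDecomposition

/-- The independent sets of the path on the `m` vertices `a, …, a + m - 1`. -/
def pathIndepSets (a m : ℕ) : Set (Finset ℕ) :=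
  {σ | (∀ i ∈ σ, a ≤ i ∧ i < a + m) ∧ ∀ i ∈ σ, i + 1 ∉ σ}

theorem pathIndepSets_one (a : ℕ) :
    pathIndepSets a 1 = {σ | σ.erase a ∈ pathIndepSets a 0} := by
  ext σ
  simp only [pathIndepSets, Set.mem_ofPred_eq, Finset.mem_erase]
  grind

theorem pathIndepSets_two (a : ℕ) :
    pathIndepSets a 2 = {σ | a + 1 ∈ σ ∧ σ.erase (a + 1) ∈ pathIndepSets a 0} ∪
      {σ | σ.erase a ∈ pathIndepSets a 0} := by
  ext σ
  simp only [pathIndepSets, Set.mem_ofPred_eq, Finset.mem_erase, Set.mem_union]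
  grind

theorem pathIndepSets_add_three (a m : ℕ) :
    pathIndepSets a (m + 3) =
      {σ | a + m + 1 ∈ σ ∧ σ.erase (a + m + 1) ∈ pathIndepSets a m} ∪
        {σ | σ.erase (a + m + 2) ∈ pathIndepSets a (m + 1)} := by
  ext σ
  simp only [pathIndepSets, Set.mem_ofPred_eq, Finset.mem_erase, Set.mem_union]
  constructor
  · rintro ⟨h1, h2⟩
    by_cases h : a + m + 1 ∈ σ
    · refine Or.inl ⟨h, ?_, fun i hi hi' => h2 i hi.2 hi'.2⟩
      rintro i ⟨hi, hiσ⟩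
      have := h1 i hiσ
      have : i ≠ a + m := by rintro rfl; exact h2 _ hiσ h
      have : i ≠ a + m + 2 := by rintro rfl; exact h2 _ h hiσ
      omega
    · refine Or.inr ⟨?_, fun i hi hi' => h2 i hi.2 hi'.2⟩
      rintro i ⟨hi, hiσ⟩
      have := h1 i hiσ
      have : i ≠ a + m + 1 := by rintro rfl; exact h hiσ
      omega
  · have split {m v : ℕ} (h1 : ∀ i, i ≠ v ∧ i ∈ σ → a ≤ i ∧ i < a + m) (i : ℕ) (hi : i ∈ σ) :
        i = v ∨ a ≤ i ∧ i < a + m :=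
      or_iff_not_imp_left.2 fun hne => h1 i ⟨hne, hi⟩
    rintro (⟨h, h1, h2⟩ | ⟨h1, h2⟩)
    all_goals
      refine ⟨fun i hi => ?_, fun i hi hi' => ?_⟩
      · have := split h1 i hi
        omega
      · have := split h1 i hi
        have := split h1 _ hi'
        exact h2 i ⟨by omega, hi⟩ ⟨by omega, hi'⟩

theorem hasIntervalDecomposition_pathIndepSets_zero (a : ℕ) :
    HasIntervalDecomposition 0 (pathIndepSets a 0) := by
  refine ⟨id, id, fun σ hσ => ⟨subset_rfl, subset_rfl, Nat.zero_le _, fun τ h1 h2 => ?_⟩⟩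
  obtain rfl : τ = σ := subset_antisymm h2 h1
  exact ⟨hσ, rfl, rfl⟩

theorem notMem_of_mem_pathIndepSets {a m v : ℕ} (hv : a + m ≤ v) :
    ∀ σ ∈ pathIndepSets a m, v ∉ σ :=
  fun _ hσ h => absurd (hσ.1 v h).2 (by omega)

theorem hasIntervalDecomposition_pathIndepSets (a m : ℕ) :
    HasIntervalDecomposition ((m + 2) / 3) (pathIndepSets a m) := by
  have h0 := hasIntervalDecomposition_pathIndepSets_zero a
  induction m using Nat.strong_induction_on with
  | _ m ih =>
    match m with
    | 0 => exact h0
    | 1 =>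
      rw [pathIndepSets_one]
      exact h0.cone (notMem_of_mem_pathIndepSets le_rfl)
    | 2 =>
      rw [pathIndepSets_two]
      refine (h0.insert (notMem_of_mem_pathIndepSets (by omega))).union
        (h0.cone (notMem_of_mem_pathIndepSets le_rfl)) (Set.disjoint_left.2 ?_)
      rintro σ ⟨h1, -⟩ h2
      exact notMem_of_mem_pathIndepSets (by omega) _ h2
        (Finset.mem_erase.2 ⟨by omega, h1⟩)
    | m + 3 =>
      rw [pathIndepSets_add_three]
      refine (((ih m (by omega)).insert (notMem_of_mem_pathIndepSets (by omega))).mono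
        (by omega)).union (((ih (m + 1) (by omega)).cone
          (notMem_of_mem_pathIndepSets (by omega))).mono (by omega)) (Set.disjoint_left.2 ?_)
      rintro σ ⟨h1, -⟩ h2
      exact notMem_of_mem_pathIndepSets (by omega) _ h2
        (Finset.mem_erase.2 ⟨by omega, h1⟩)

theorem setOf_cyclicIndep_eq (m : ℕ) :
    {σ | CyclicIndep (m + 3) σ} =
      {σ | m + 3 ∈ σ ∧ σ.erase (m + 3) ∈ pathIndepSets 2 m} ∪ pathIndepSets 1 (m + 2) := by
  ext σ
  simp only [CyclicIndep, pathIndepSets, Set.mem_ofPred_eq, Finset.mem_erase, Set.mem_union,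
    Finset.subset_iff, Finset.mem_Icc]
  constructor
  · rintro ⟨h1, h2, h3⟩
    have h4 : ∀ i ∈ σ, i + 1 ∉ σ := fun i hi hi' =>
      h2 i (h1 hi).1 (by have := (h1 hi').2; omega) ⟨hi, hi'⟩
    by_cases h : m + 3 ∈ σ
    · refine Or.inl ⟨h, ?_, by grind⟩
      rintro i ⟨hi, hiσ⟩
      have := h1 hiσ
      have : i ≠ 1 := by rintro rfl; exact h3 ⟨hiσ, h⟩
      have : i ≠ m + 2 := by rintro rfl; exact h4 _ hiσ h
      omega
    · refine Or.inr ⟨fun i hi => ?_, h4⟩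
      have := h1 hi
      have : i ≠ m + 3 := by rintro rfl; exact h hi
      omega
  · rintro (⟨h, h1, h2⟩ | ⟨h1, h2⟩)
    · refine ⟨fun i hi => ?_, fun i hi hin => ?_, ?_⟩
      · by_cases h' : i = m + 3
        · omega
        · have := h1 i ⟨h', hi⟩
          omega
      · rintro ⟨hi1, hi2⟩
        have := h1 i ⟨by omega, hi1⟩
        exact h2 i ⟨by omega, hi1⟩ ⟨by omega, hi2⟩
      · rintro ⟨h3, -⟩
        have := h1 1 ⟨by omega, h3⟩
        omega
    · refine ⟨fun i hi => ?_, fun i _ _ hi => h2 i hi.1 hi.2, fun hi => ?_⟩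
      · have := h1 i hi
        omega
      · have := h1 _ hi.2
        omega

theorem hasIntervalDecomposition_cyclicIndep (m : ℕ) :
    HasIntervalDecomposition ((m + 4) / 3) {σ | CyclicIndep (m + 3) σ} := by
  rw [setOf_cyclicIndep_eq]
  refine (((hasIntervalDecomposition_pathIndepSets 2 m).insert
    (notMem_of_mem_pathIndepSets (by omega))).mono (by omega)).union
      (hasIntervalDecomposition_pathIndepSets 1 (m + 2)) (Set.disjoint_left.2 ?_)
  rintro σ ⟨h1, -⟩ h2
  exact notMem_of_mem_pathIndepSets (by omega) _ h2 h1

/-- A member of `P` that is maximal under inclusion is the upper end of its interval. -/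
theorem IntervalPartition.le_card_of_maximal {n d : ℕ} {P : Set (Finset ℕ)}
    (part : IntervalPartition n P) (hd : ∀ i, d ≤ (part.G i).card) {M : Finset ℕ}
    (hM : Maximal (· ∈ P) M) : d ≤ M.card := by
  obtain ⟨i, hi⟩ := (part.cover M).1 hM.prop
  have hG := (part.cover (part.G i)).2 ⟨i, Finset.mem_Icc.2 ⟨part.le i, le_rfl⟩⟩
  exact (hd i).trans (Finset.card_le_card (hM.le_of_ge hG (Finset.mem_Icc.1 hi).2))

theorem maximal_cyclicIndep_image (k : ℕ) (hk : 1 ≤ k) :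
    Maximal (· ∈ {σ | CyclicIndep (3 * k + 2) σ})
      ((Finset.range (k + 1)).image fun j => 3 * j + 1) := by
  have hmem : ∀ x, x ∈ (Finset.range (k + 1)).image (fun j => 3 * j + 1) ↔
      x % 3 = 1 ∧ x ≤ 3 * k + 1 := by
    intro x
    simp only [Finset.mem_image, Finset.mem_range]
    exact ⟨by rintro ⟨j, hj, rfl⟩; omega, fun h => ⟨x / 3, by omega, by omega⟩⟩
  refine ⟨⟨fun x hx => ?_, fun i _ _ => ?_, ?_⟩, fun τ hτ hle x hx => ?_⟩
  · rw [hmem] at hx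
    rw [Finset.mem_Icc]
    omega
  · rw [hmem, hmem]
    omega
  · rw [hmem, hmem]
    omega
  · obtain ⟨h1, h2, h3⟩ := hτ
    have hx' := Finset.mem_Icc.1 (h1 hx)
    rw [hmem]
    by_contra hne
    have hsub : ∀ y, y % 3 = 1 → y ≤ 3 * k + 1 → y ∈ τ := fun y hy hy' =>
      hle ((hmem y).2 ⟨hy, hy'⟩)
    by_cases hx0 : x % 3 = 0
    · exact h2 x hx'.1 (by omega) ⟨hx, hsub _ (by omega) (by omega)⟩
    · have hpred := hsub (x - 1) (by omega) (by omega)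
      refine h2 (x - 1) (by omega) (by omega) ⟨hpred, ?_⟩
      rwa [Nat.sub_add_cancel hx'.1]

/-- For `n ≥ 5` with `n = 3k+2`, the Stanley depth of the family of
cyclically independent subsets of `[n]` equals `k+1 = ⌈(n-1)/3⌉`. -/
theorem stmt_1 (n k : ℕ) (hn : 5 ≤ n) (hk : n = 3 * k + 2) :
    stanleyDepth n {σ : Finset ℕ | CyclicIndep n σ} = k + 1 := by
  refine IsGreatest.csSup_eq ⟨?_, ?_⟩
  · obtain ⟨m, rfl⟩ : ∃ m, n = m + 3 := ⟨n - 3, by omega⟩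
    exact ((hasIntervalDecomposition_cyclicIndep m).mono
      (by omega)).exists_intervalPartition fun σ hσ => hσ.1
  · rintro d ⟨part, hd⟩
    subst hk
    refine (part.le_card_of_maximal hd (maximal_cyclicIndep_image k (by omega))).trans ?_
    exact Finset.card_image_le.trans (Finset.card_range _).le
end

section
/- Let n ≥ 7 with n ≡ 1 (mod 3), say n = 3k+1 with k ≥ 2. Then the Stanley depth of the family P of cyclically independent subsets of [n] is at most k+1 = ⌈n/3⌉. -/
/-- The independent set `{1, 4, …, 3k-2} ∪ {3k}` of the cycle on `[3k+1]`. -/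
def sparseIndep (k : ℕ) : Finset ℕ :=
  insert (3 * k) ((Finset.range k).image fun i => 3 * i + 1)

theorem mem_sparseIndep {k x : ℕ} :
    x ∈ sparseIndep k ↔ x = 3 * k ∨ (x % 3 = 1 ∧ x < 3 * k) := by
  simp only [sparseIndep, Finset.mem_insert, Finset.mem_image, Finset.mem_range]
  refine or_congr_right ⟨?_, fun h => ⟨x / 3, ?_, ?_⟩⟩
  · rintro ⟨i, hi, rfl⟩
    omega
  · omega
  · omega

theorem card_sparseIndep_le (k : ℕ) : (sparseIndep k).card ≤ k + 1 := by
  refine (Finset.card_insert_le _ _).trans (Nat.succ_le_succ ?_)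
  simpa using Finset.card_image_le (s := Finset.range k) (f := fun i => 3 * i + 1)

theorem cyclicIndep_sparseIndep {k : ℕ} (hk : 1 ≤ k) :
    CyclicIndep (3 * k + 1) (sparseIndep k) := by
  refine ⟨fun x hx => ?_, fun i _ _ h => ?_, fun h => ?_⟩
  · rw [mem_sparseIndep] at hx
    rw [Finset.mem_Icc]
    omega
  · rw [mem_sparseIndep, mem_sparseIndep] at h
    omega
  · rw [mem_sparseIndep, mem_sparseIndep] at h
    omega

/-- `sparseIndep k` is a maximal independent set of the cycle on `[3k+1]`. -/
theorem subset_sparseIndep_of_cyclicIndep {k : ℕ} (hk : 1 ≤ k) {G : Finset ℕ}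
    (hG : CyclicIndep (3 * k + 1) G) (h : sparseIndep k ⊆ G) : G ⊆ sparseIndep k := by
  intro x hx
  obtain ⟨hsub, hadj, -⟩ := hG
  have hx' := Finset.mem_Icc.mp (hsub hx)
  by_contra hnot
  rw [mem_sparseIndep] at hnot
  by_cases hprev : x % 3 = 2 ∨ x = 3 * k + 1
  · refine hadj (x - 1) (by omega) (by omega) ⟨h (mem_sparseIndep.mpr (by omega)), ?_⟩
    rwa [Nat.sub_add_cancel hx'.1]
  · exact hadj x hx'.1 (by omega) ⟨hx, h (mem_sparseIndep.mpr (by omega))⟩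

/-- For `n ≥ 7` with `n = 3k+1`, `k ≥ 2`, the Stanley depth of the
family of cyclically independent subsets of `[n]` is at most `k+1 = ⌈n/3⌉`. -/
theorem stmt_2 (n k : ℕ) (hn : 7 ≤ n) (hk : n = 3 * k + 1) (hk2 : 2 ≤ k) :
    stanleyDepth n {σ : Finset ℕ | CyclicIndep n σ} ≤ k + 1 := by
  subst hk
  refine csSup_le' ?_
  rintro m ⟨part, hm⟩
  obtain ⟨i, hi⟩ := (part.cover (sparseIndep k)).mp (cyclicIndep_sparseIndep (by omega))
  have hG : CyclicIndep (3 * k + 1) (part.G i) :=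
    (part.cover (part.G i)).mpr ⟨i, Finset.mem_Icc.mpr ⟨part.le i, le_rfl⟩⟩
  have hle := subset_sparseIndep_of_cyclicIndep (by omega) hG (Finset.mem_Icc.mp hi).2
  exact (hm i).trans ((Finset.card_le_card hle).trans (card_sparseIndep_le k))
end

section
/- Let n = 3k+1 with k ≥ 2 and σ = {1, 4, 7, …, 3k−2} ∪ {3k} ⊆ [n]. Then σ is cyclically independent of cardinality k+1, and no cyclically independent subset of [n] of cardinality k+2 contains σ. -/
/-- For `n = 3k+1`, `k ≥ 2`, and `σ = {1, 4, …, 3k-2} ∪ {3k}`: `σ` is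
cyclically independent of cardinality `k+1`, and no cyclically independent subset
of `[n]` of cardinality `k+2` contains `σ`. -/
theorem stmt_6 (n k : ℕ) (hk : 2 ≤ k) (hn : n = 3 * k + 1) :
    CyclicIndep n (insert (3 * k) ((Finset.range k).image (fun i => 3 * i + 1))) ∧
      (insert (3 * k) ((Finset.range k).image (fun i => 3 * i + 1))).card = k + 1 ∧
      ∀ τ : Finset ℕ, CyclicIndep n τ →
        insert (3 * k) ((Finset.range k).image (fun i => 3 * i + 1)) ⊆ τ →
        τ.card ≠ k + 2 := by
  subst hn
  have hmem : ∀ x, x ∈ insert (3 * k) ((Finset.range k).image (fun i => 3 * i + 1)) ↔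
      x = 3 * k ∨ (x < 3 * k ∧ x % 3 = 1) := by
    intro x
    simp only [Finset.mem_insert, Finset.mem_image, Finset.mem_range]
    refine or_congr_right ⟨?_, fun h => ⟨x / 3, by omega, by omega⟩⟩
    rintro ⟨i, hi, rfl⟩
    omega
  have hcard : (insert (3 * k) ((Finset.range k).image (fun i => 3 * i + 1))).card = k + 1 := by
    rw [Finset.card_insert_of_notMem, Finset.card_image_of_injective, Finset.card_range]
    · intro a b h
      simpa using h
    · simp only [Finset.mem_image, not_exists, not_and]
      omega
  refine ⟨⟨fun x hx => ?_, fun i _ _ => ?_, ?_⟩, hcard, fun τ hτ hsub hτcard => ?_⟩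
  · rw [hmem] at hx
    rw [Finset.mem_Icc]
    omega
  · rw [hmem, hmem]
    omega
  · rw [hmem, hmem]
    omega
  · obtain ⟨hIcc, hadj, -⟩ := hτ
    -- every vertex outside `σ` has a neighbour in `σ`, so `τ` cannot be larger than `σ`
    have hle : τ ⊆ insert (3 * k) ((Finset.range k).image (fun i => 3 * i + 1)) := by
      intro x hx
      have hx' := Finset.mem_Icc.mp (hIcc hx)
      by_contra hxσ
      rw [hmem] at hxσ
      by_cases hpred : x = 3 * k + 1 ∨ x % 3 = 2
      · have hp : x - 1 ∈ τ := hsub ((hmem _).mpr (by omega))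
        refine hadj (x - 1) (by omega) (by omega) ⟨hp, ?_⟩
        rwa [Nat.sub_add_cancel hx'.1]
      · exact hadj x hx'.1 (by omega) ⟨hx, hsub ((hmem _).mpr (by omega))⟩
    have := Finset.card_le_card hle
    omega
end

section
/- Let n = 3k+2 with k ≥ 1 and σ = {1, 4, 7, …, 3k+1} ⊆ [n]. Then σ is cyclically independent of cardinality k+1, and no cyclically independent subset of [n] of cardinality k+2 contains σ. -/
/-- For `n = 3k+2`, `k ≥ 1`, and `σ = {1, 4, …, 3k+1}`: `σ` is
cyclically independent of cardinality `k+1`, and no cyclically independent subset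
of `[n]` of cardinality `k+2` contains `σ`. -/
theorem stmt_7 (n k : ℕ) (hk : 1 ≤ k) (hn : n = 3 * k + 2) :
    CyclicIndep n ((Finset.range (k + 1)).image (fun i => 3 * i + 1)) ∧
      ((Finset.range (k + 1)).image (fun i => 3 * i + 1)).card = k + 1 ∧
      ∀ τ : Finset ℕ, CyclicIndep n τ →
        (Finset.range (k + 1)).image (fun i => 3 * i + 1) ⊆ τ →
        τ.card ≠ k + 2 := by
  have mem (x : ℕ) : x ∈ (Finset.range (k + 1)).image (fun i => 3 * i + 1) ↔
      x % 3 = 1 ∧ x ≤ 3 * k + 1 := by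
    simp only [Finset.mem_image, Finset.mem_range]
    constructor
    · rintro ⟨i, hi, rfl⟩
      omega
    · rintro ⟨h, hx⟩
      exact ⟨x / 3, by omega, by omega⟩
  have card : ((Finset.range (k + 1)).image (fun i => 3 * i + 1)).card = k + 1 := by
    rw [Finset.card_image_of_injective _ (fun a b h => by simpa using h), Finset.card_range]
  refine ⟨⟨fun x hx => ?_, fun i _ _ => ?_, ?_⟩, card, ?_⟩
  · rw [mem] at hx
    rw [Finset.mem_Icc]
    omega
  · simp only [mem]
    omega
  · simp only [mem]
    omega
  · rintro τ ⟨hτ, hadj, -⟩ hsub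
    have hle : τ ⊆ (Finset.range (k + 1)).image (fun i => 3 * i + 1) := by
      intro x hx
      have hxn := Finset.mem_Icc.mp (hτ hx)
      rw [mem]
      by_contra hx'
      obtain h | h : x % 3 = 0 ∨ x % 3 = 2 := by omega
      · exact hadj x hxn.1 (by omega) ⟨hx, hsub ((mem _).2 (by omega))⟩
      · refine hadj (x - 1) (by omega) (by omega) ⟨hsub ((mem _).2 (by omega)), ?_⟩
        rwa [Nat.sub_add_cancel hxn.1]
    have := Finset.card_le_card hle
    omega
end

section
/- Let n ≥ 1 and 0 ≤ k ≤ n be integers, and let P = {σ ⊆ [n] : |σ| ≤ k}. Then there exists a partition P = ⋃_{i=1}^r [C_i, D_i] of P into pairwise disjoint intervals such that |D_i| = k for every i. -/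
/-- The subsets of `A` with at most `k ≤ #A` elements are partitioned by finitely many
intervals whose upper ends have exactly `k` elements. -/
theorem Finset.exists_interval_partition_card_le {α : Type*} [DecidableEq α] (A : Finset α) :
    ∀ k ≤ A.card, ∃ S : Finset (Finset α × Finset α),
      (∀ p ∈ S, p.1 ⊆ p.2 ∧ p.2 ⊆ A ∧ p.2.card = k) ∧
      (∀ σ ⊆ A, σ.card ≤ k → ∃ p ∈ S, p.1 ⊆ σ ∧ σ ⊆ p.2) ∧
      ∀ p ∈ S, ∀ q ∈ S, ∀ σ, p.1 ⊆ σ → σ ⊆ p.2 → q.1 ⊆ σ → σ ⊆ q.2 → p = q := by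
  induction A using Finset.induction_on with
  | empty =>
    intro k hk
    obtain rfl : k = 0 := by simpa using hk
    exact ⟨{(∅, ∅)}, by simp⟩
  | insert a A ha ih =>
    intro k hk
    rw [Finset.card_insert_of_notMem ha] at hk
    obtain rfl | hk' := hk.eq_or_lt
    · refine ⟨{(∅, insert a A)}, by simp [ha], ?_, by simp⟩
      intro σ hσ _
      simpa using hσ
    obtain _ | k := k
    · exact ⟨{(∅, ∅)}, by simp⟩
    obtain ⟨S, hS, hScover, hSuniq⟩ := ih (k + 1) (by omega)
    obtain ⟨T, hT, hTcover, hTuniq⟩ := ih k (by omega)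
    have haT : ∀ p ∈ T, a ∉ p.2 := fun p hp h => ha ((hT p hp).2.1 h)
    have haT' : ∀ p ∈ T, a ∉ p.1 := fun p hp h => haT p hp ((hT p hp).1 h)
    refine ⟨S ∪ T.image fun p => (insert a p.1, insert a p.2), ?_, ?_, ?_⟩
    · intro p hp
      obtain hp | hp := Finset.mem_union.1 hp
      · obtain ⟨h₁, h₂, h₃⟩ := hS p hp
        exact ⟨h₁, h₂.trans (Finset.subset_insert _ _), h₃⟩
      · obtain ⟨q, hq, rfl⟩ := Finset.mem_image.1 hp
        obtain ⟨h₁, h₂, h₃⟩ := hT q hq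
        refine ⟨Finset.insert_subset_insert _ h₁, Finset.insert_subset_insert _ h₂, ?_⟩
        rw [Finset.card_insert_of_notMem (haT q hq), h₃]
    · intro σ hσ hcard
      by_cases haσ : a ∈ σ
      · obtain ⟨p, hp, h₁, h₂⟩ := hTcover (σ.erase a)
          (Finset.subset_insert_iff.1 hσ) (by rw [Finset.card_erase_of_mem haσ]; omega)
        refine ⟨_, Finset.mem_union_right _ (Finset.mem_image_of_mem _ hp), ?_, ?_⟩
        · exact Finset.insert_subset haσ (h₁.trans (Finset.erase_subset _ _))
        · exact Finset.subset_insert_iff.2 h₂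
      · obtain ⟨p, hp, h⟩ :=
          hScover σ ((Finset.subset_insert_iff_of_notMem haσ).1 hσ) hcard
        exact ⟨p, Finset.mem_union_left _ hp, h⟩
    · intro p hp q hq σ hp₁ hp₂ hq₁ hq₂
      obtain hp | hp := Finset.mem_union.1 hp <;> obtain hq | hq := Finset.mem_union.1 hq
      · exact hSuniq p hp q hq σ hp₁ hp₂ hq₁ hq₂
      · obtain ⟨q, hq, rfl⟩ := Finset.mem_image.1 hq
        exact absurd ((hS p hp).2.1 (hp₂ (hq₁ (Finset.mem_insert_self _ _)))) ha
      · obtain ⟨p, hp, rfl⟩ := Finset.mem_image.1 hp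
        exact absurd ((hS q hq).2.1 (hq₂ (hp₁ (Finset.mem_insert_self _ _)))) ha
      · obtain ⟨p, hpT, rfl⟩ := Finset.mem_image.1 hp
        obtain ⟨q, hqT, rfl⟩ := Finset.mem_image.1 hq
        rw [hTuniq p hpT q hqT (σ.erase a)
          (Finset.subset_erase.2 ⟨(Finset.subset_insert _ _).trans hp₁, haT' p hpT⟩)
          (Finset.subset_insert_iff.1 hp₂)
          (Finset.subset_erase.2 ⟨(Finset.subset_insert _ _).trans hq₁, haT' q hqT⟩)
          (Finset.subset_insert_iff.1 hq₂)]

/-- For `n ≥ 1` and `0 ≤ k ≤ n`, the family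
`P = {σ ⊆ [n] : |σ| ≤ k}` admits a partition into pairwise disjoint intervals
`[C i, D i]` with `|D i| = k` for every `i`. -/
theorem stmt_9 (n k : ℕ) (hn : 1 ≤ n) (hk : k ≤ n) :
    ∃ part : IntervalPartition n
        {σ : Finset ℕ | σ ⊆ Finset.Icc 1 n ∧ σ.card ≤ k},
      ∀ i, (part.G i).card = k := by
  obtain ⟨S, hS, hcover, huniq⟩ :=
    (Finset.Icc 1 n).exists_interval_partition_card_le k (by simpa using hk)
  let p : Fin S.card → Finset ℕ × Finset ℕ := fun i => (S.equivFin.symm i).1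
  have hp : ∀ i, p i ∈ S := fun i => (S.equivFin.symm i).2
  refine ⟨⟨S.card, fun i => (p i).1, fun i => (p i).2, fun i => (hS _ (hp i)).1,
    fun i => (hS _ (hp i)).2.1, fun i j hij => ?_, fun σ => ⟨?_, ?_⟩⟩,
    fun i => (hS _ (hp i)).2.2⟩
  · refine Finset.disjoint_left.2 fun σ hi hj => hij ?_
    rw [Finset.mem_Icc] at hi hj
    exact S.equivFin.symm.injective
      (Subtype.ext (huniq _ (hp i) _ (hp j) σ hi.1 hi.2 hj.1 hj.2))
  · rintro ⟨hσ, hcard⟩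
    obtain ⟨q, hq, h⟩ := hcover σ hσ hcard
    refine ⟨S.equivFin ⟨q, hq⟩, ?_⟩
    simpa [p] using h
  · rintro ⟨i, hi⟩
    have hσ := (Finset.mem_Icc.1 hi).2
    exact ⟨hσ.trans (hS _ (hp i)).2.1, (Finset.card_le_card hσ).trans (hS _ (hp i)).2.2.le⟩
end

section
/- Let P be a family of subsets of [n] admitting a partition into intervals [F_i,G_i] with |G_i| ≥ k for all i (i.e., sdepth(P) ≥ k). Then there exists a partition of P into pairwise disjoint intervals such that every interval [C,D] of this partition with |C| < k satisfies |D| = k. -/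
/-- An interval `[F, G]` with `k ≤ |G|` is partitioned by finitely many intervals `[C, D]`
in which `|C| < k` forces `|D| = k`. -/
theorem exists_refinement_Icc (k : ℕ) (F G : Finset ℕ) (hFG : F ⊆ G) (hk : k ≤ G.card) :
    ∃ T : Finset (Finset ℕ × Finset ℕ),
      (∀ p ∈ T, F ⊆ p.1 ∧ p.1 ⊆ p.2 ∧ p.2 ⊆ G ∧ (p.1.card < k → p.2.card = k)) ∧
      ∀ σ ∈ Finset.Icc F G, ∃! p, p ∈ T ∧ σ ∈ Finset.Icc p.1 p.2 := by
  induction hm : (G \ F).card using Nat.strong_induction_on generalizing F G with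
  | _ m ih =>
  subst hm
  by_cases hgood : F.card < k → G.card = k
  · refine ⟨{(F, G)}, by simpa using ⟨hFG, hgood⟩, fun σ hσ => ⟨(F, G), by simpa using hσ, ?_⟩⟩
    rintro p ⟨hp, -⟩
    simpa using hp
  · push Not at hgood
    obtain ⟨hF, hG⟩ := hgood
    obtain ⟨x, hxG, hxF⟩ := Finset.exists_mem_notMem_of_card_lt_card (hF.trans_le hk)
    have hlt₁ : (G.erase x \ F).card < (G \ F).card :=
      Finset.card_lt_card ⟨Finset.sdiff_subset_sdiff (Finset.erase_subset x G) subset_rfl,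
        fun h => by simpa using h (Finset.mem_sdiff.2 ⟨hxG, hxF⟩)⟩
    have hlt₂ : (G \ insert x F).card < (G \ F).card :=
      Finset.card_lt_card ⟨Finset.sdiff_subset_sdiff subset_rfl (Finset.subset_insert x F),
        fun h => by simpa using h (Finset.mem_sdiff.2 ⟨hxG, hxF⟩)⟩
    obtain ⟨T₁, hT₁, hU₁⟩ := ih _ hlt₁ F (G.erase x) (Finset.subset_erase.2 ⟨hFG, hxF⟩)
      (by rw [Finset.card_erase_of_mem hxG]; omega) rfl
    obtain ⟨T₂, hT₂, hU₂⟩ := ih _ hlt₂ (insert x F) G (Finset.insert_subset hxG hFG) hk rfl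
    refine ⟨T₁ ∪ T₂, fun p hp => ?_, fun σ hσ => ?_⟩
    · rcases Finset.mem_union.1 hp with hp | hp
      · obtain ⟨h₁, h₂, h₃, h₄⟩ := hT₁ p hp
        exact ⟨h₁, h₂, h₃.trans (Finset.erase_subset x G), h₄⟩
      · obtain ⟨h₁, h₂, h₃, h₄⟩ := hT₂ p hp
        exact ⟨(Finset.subset_insert x F).trans h₁, h₂, h₃, h₄⟩
    · rw [Finset.mem_Icc] at hσ
      by_cases hx : x ∈ σ
      · obtain ⟨p, ⟨hp, hσp⟩, huniq⟩ :=
          hU₂ σ (Finset.mem_Icc.2 ⟨Finset.insert_subset hx hσ.1, hσ.2⟩)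
        refine ⟨p, ⟨Finset.mem_union_right _ hp, hσp⟩, fun q ⟨hq, hσq⟩ => ?_⟩
        refine (Finset.mem_union.1 hq).elim (fun hq => ?_) fun hq => huniq q ⟨hq, hσq⟩
        exact absurd ((hT₁ q hq).2.2.1 ((Finset.mem_Icc.1 hσq).2 hx)) (Finset.notMem_erase x G)
      · obtain ⟨p, ⟨hp, hσp⟩, huniq⟩ :=
          hU₁ σ (Finset.mem_Icc.2 ⟨hσ.1, Finset.subset_erase.2 ⟨hσ.2, hx⟩⟩)
        refine ⟨p, ⟨Finset.mem_union_left _ hp, hσp⟩, fun q ⟨hq, hσq⟩ => ?_⟩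
        refine (Finset.mem_union.1 hq).elim (fun hq => huniq q ⟨hq, hσq⟩) fun hq => ?_
        exact absurd ((Finset.mem_Icc.1 hσq).1 ((hT₂ q hq).1 (Finset.mem_insert_self x F))) hx

/-- If a family `P` of subsets of `[n]` admits an interval partition
with `|G i| ≥ k` for all `i` (i.e. `sdepth(P) ≥ k`), then it admits an interval
partition in which every interval `[C, D]` with `|C| < k` has `|D| = k`. -/
theorem stmt_10 (n k : ℕ) (P : Set (Finset ℕ))
    (part0 : IntervalPartition n P) (h0 : ∀ i, k ≤ (part0.G i).card) :
    ∃ part : IntervalPartition n P,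
      ∀ i, (part.F i).card < k → (part.G i).card = k := by
  choose T hT hU using fun i => exists_refinement_Icc k _ _ (part0.le i) (h0 i)
  have mem_Icc_of_mem {i p σ} (hp : p ∈ T i) (hσ : σ ∈ Finset.Icc p.1 p.2) :
      σ ∈ Finset.Icc (part0.F i) (part0.G i) := by
    rw [Finset.mem_Icc] at hσ ⊢
    exact ⟨(hT i p hp).1.trans hσ.1, hσ.2.trans (hT i p hp).2.2.1⟩
  let S := Finset.univ.biUnion T
  let e := S.equivFin.symm
  have he (j) : ∃ i, (e j).1 ∈ T i := by
    simpa only [S, Finset.mem_biUnion, Finset.mem_univ, true_and] using (e j).2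
  refine ⟨⟨S.card, fun j => (e j).1.1, fun j => (e j).1.2, fun j => ?_, fun j => ?_,
    fun j l hjl => ?_, fun σ => ?_⟩, fun j => ?_⟩
  · obtain ⟨i, hi⟩ := he j
    exact (hT i _ hi).2.1
  · obtain ⟨i, hi⟩ := he j
    exact (hT i _ hi).2.2.1.trans (part0.sub i)
  · refine Finset.disjoint_left.2 fun σ hj hl => hjl ?_
    obtain ⟨a, ha⟩ := he j
    obtain ⟨b, hb⟩ := he l
    have hab : a = b := by
      by_contra hab
      exact Finset.disjoint_left.1 (part0.disj a b hab) (mem_Icc_of_mem ha hj)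
        (mem_Icc_of_mem hb hl)
    subst hab
    exact e.injective (Subtype.ext ((hU a σ (mem_Icc_of_mem ha hj)).unique ⟨ha, hj⟩ ⟨hb, hl⟩))
  · rw [part0.cover]
    constructor
    · rintro ⟨i, hi⟩
      obtain ⟨p, ⟨hp, hσ⟩, -⟩ := hU i σ hi
      exact ⟨e.symm ⟨p, Finset.mem_biUnion.2 ⟨i, Finset.mem_univ i, hp⟩⟩, by simpa using hσ⟩
    · rintro ⟨j, hj⟩
      obtain ⟨i, hi⟩ := he j
      exact ⟨i, mem_Icc_of_mem hi hj⟩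
  · obtain ⟨i, hi⟩ := he j
    exact (hT i _ hi).2.2.2
end

section
/- Let P be a nonempty family of subsets of [n] with sdepth(P) ≥ k. For 0 ≤ t ≤ k let β_t = |{σ ∈ P : |σ| = t}|, and define integers α_0, …, α_k recursively by α_0 = β_0 and α_t = β_t − Σ_{j=0}^{t−1} C(k−j, t−j) · α_j. Then α_t ≥ 0 for all 0 ≤ t ≤ k. -/
open Finset in
/-- `β` is, in degrees up to `k`, a combination with natural coefficients `γ j` of the rank
vectors `t ↦ (k - j).choose (t - j)` of intervals `[F, G]` with `F.card = j` and `G.card = k`. -/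
def IsIntervalCombination (k : ℕ) (β : ℕ → ℕ) : Prop :=
  ∃ γ : ℕ → ℕ, ∀ t ≤ k, β t = ∑ j ∈ range (t + 1), (k - j).choose (t - j) * γ j

open Finset in
theorem sum_range_choose_add_self (m n : ℕ) :
    ∑ i ∈ range (n + 1), (m + i).choose i = (m + n + 1).choose n := by
  induction n with
  | zero => simp
  | succ n ih =>
    rw [sum_range_succ, ih, show m + (n + 1) + 1 = (m + n + 1) + 1 by ring,
      Nat.choose_succ_succ]
    rfl

open Finset in
theorem sum_Ico_choose_sub_sub {k l t : ℕ} (hlt : l ≤ t) (htk : t ≤ k) :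
    ∑ j ∈ Ico l (t + 1), (k - j).choose (t - j) = (k + 1 - l).choose (t - l) := by
  have h := sum_range_choose_add_self (k - t) (t - l)
  rw [show k - t + (t - l) + 1 = k + 1 - l by omega] at h
  rw [← h, sum_Ico_eq_sum_range, show t + 1 - l = t - l + 1 by omega, ← sum_range_reflect]
  refine sum_congr rfl fun i hi => ?_
  have := mem_range.1 hi
  congr 1 <;> omega

namespace IsIntervalCombination

open Finset

theorem of_succ {k : ℕ} {β : ℕ → ℕ} (h : IsIntervalCombination (k + 1) β) :
    IsIntervalCombination k β := by
  obtain ⟨γ, hγ⟩ := h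
  refine ⟨fun j => ∑ l ∈ range (j + 1), γ l, fun t ht => ?_⟩
  simp_rw [hγ t (by omega), mul_sum, range_eq_Ico]
  rw [← sum_Ico_Ico_comm]
  refine sum_congr rfl fun l hl => ?_
  rw [← sum_mul, sum_Ico_choose_sub_sub (Nat.lt_succ_iff.1 (mem_Ico.1 hl).2) ht]

theorem mono {k m : ℕ} {β : ℕ → ℕ} (hkm : k ≤ m) (h : IsIntervalCombination m β) :
    IsIntervalCombination k β := by
  induction m, hkm using Nat.le_induction with
  | base => exact h
  | succ m _ ih => exact ih h.of_succ

theorem sum {ι : Type*} {s : Finset ι} {k : ℕ} {β : ι → ℕ → ℕ}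
    (h : ∀ i ∈ s, IsIntervalCombination k (β i)) :
    IsIntervalCombination k fun t => ∑ i ∈ s, β i t := by
  choose! γ hγ using h
  refine ⟨fun j => ∑ i ∈ s, γ i j, fun t ht => ?_⟩
  simp_rw [mul_sum]
  rw [sum_comm]
  exact sum_congr rfl fun i hi => hγ i hi t ht

end IsIntervalCombination

open Finset in
theorem card_filter_Icc_card_eq {α : Type*} [DecidableEq α] {F G : Finset α} (h : F ⊆ G) (t : ℕ) :
    #{σ ∈ Icc F G | #σ = t} = if #F ≤ t then (#G - #F).choose (t - #F) else 0 := by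
  split_ifs with ht
  · rw [← card_sdiff_of_subset h, ← card_powersetCard]
    refine card_nbij' (· \ F) (F ∪ ·) ?_ ?_ ?_ ?_
    · intro σ hσ
      simp only [coe_filter, mem_Icc, Set.mem_ofPred_eq] at hσ
      simp only [mem_coe, mem_powersetCard]
      exact ⟨sdiff_subset_sdiff hσ.1.2 subset_rfl, by rw [card_sdiff_of_subset hσ.1.1, hσ.2]⟩
    · intro τ hτ
      simp only [mem_coe, mem_powersetCard] at hτ
      have hd : Disjoint F τ := disjoint_sdiff.mono_right hτ.1
      simp only [coe_filter, mem_Icc, Set.mem_ofPred_eq]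
      refine ⟨⟨subset_union_left, union_subset h (hτ.1.trans sdiff_subset)⟩, ?_⟩
      rw [card_union_of_disjoint hd]
      omega
    · intro σ hσ
      simp only [coe_filter, mem_Icc, Set.mem_ofPred_eq] at hσ
      exact union_sdiff_of_subset hσ.1.1
    · intro τ hτ
      simp only [mem_coe, mem_powersetCard] at hτ
      exact union_sdiff_cancel_left (disjoint_sdiff.mono_right hτ.1)
  · rw [card_eq_zero, filter_eq_empty_iff]
    rintro σ hσ rfl
    exact ht (card_le_card (mem_Icc.1 hσ).1)

open Finset in
theorem isIntervalCombination_card_Icc {α : Type*} [DecidableEq α] {F G : Finset α} {k : ℕ}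
    (h : F ⊆ G) (hk : k ≤ #G) :
    IsIntervalCombination k fun t => #{σ ∈ Icc F G | #σ = t} := by
  refine IsIntervalCombination.mono hk ⟨fun j => if j = #F then 1 else 0, fun t _ => ?_⟩
  simp [card_filter_Icc_card_eq h]

namespace IntervalPartition

open Finset

variable {n : ℕ} {P : Set (Finset ℕ)} (part : IntervalPartition n P)

theorem ncard_card_eq (t : ℕ) :
    Set.ncard {σ ∈ P | #σ = t} = ∑ i, #{σ ∈ Icc (part.F i) (part.G i) | #σ = t} := by
  rw [← card_biUnion, ← Set.ncard_coe_finset]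
  · congr 1
    ext σ
    simp [part.cover]
  · exact fun i _ j _ hij => disjoint_filter_filter (part.disj i j hij)

theorem isIntervalCombination {k : ℕ} (hk : ∀ i, k ≤ #(part.G i)) :
    IsIntervalCombination k fun t => Set.ncard {σ ∈ P | #σ = t} := by
  simp_rw [part.ncard_card_eq]
  exact .sum fun i _ => isIntervalCombination_card_Icc (part.le i) (hk i)

end IntervalPartition

theorem exists_intervalPartition_of_le_stanleyDepth {n k : ℕ} {P : Set (Finset ℕ)}
    (hne : P.Nonempty) (hk0 : 0 < k) (hk : k ≤ stanleyDepth n P) :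
    ∃ part : IntervalPartition n P, ∀ i, k ≤ (part.G i).card := by
  have hbdd : BddAbove {k : ℕ | ∃ part : IntervalPartition n P, ∀ i, k ≤ (part.G i).card} := by
    obtain ⟨σ, hσ⟩ := hne
    refine ⟨n, ?_⟩
    rintro m ⟨part, hm⟩
    obtain ⟨i, -⟩ := (part.cover σ).1 hσ
    simpa using (hm i).trans (Finset.card_le_card (part.sub i))
  have hnonempty :
      {k : ℕ | ∃ part : IntervalPartition n P, ∀ i, k ≤ (part.G i).card}.Nonempty := by
    by_contra h
    rw [stanleyDepth, Set.not_nonempty_iff_eq_empty.1 h, csSup_empty, Nat.bot_eq_zero] at hk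
    omega
  obtain ⟨part, hpart⟩ := Nat.sSup_mem hnonempty hbdd
  exact ⟨part, fun i => hk.trans (hpart i)⟩


/-- Let `P` be a nonempty family of subsets of `[n]` with
`sdepth(P) ≥ k`.  With `β t = |{σ ∈ P : |σ| = t}|`, define `α 0 = β 0` and
`α t = β t - ∑_{j=0}^{t-1} C(k-j, t-j) · α j`.  Then `α t ≥ 0` for all `0 ≤ t ≤ k`. -/
theorem stmt_13 (n k : ℕ) (P : Set (Finset ℕ)) (hne : P.Nonempty)
    (hP : ∀ σ ∈ P, σ ⊆ Finset.Icc 1 n) (hk : k ≤ stanleyDepth n P)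
    (α : ℕ → ℤ)
    (hα0 : α 0 = (Set.ncard {σ ∈ P | σ.card = 0} : ℤ))
    (hαt : ∀ t, 1 ≤ t → t ≤ k →
      α t = (Set.ncard {σ ∈ P | σ.card = t} : ℤ) -
        ∑ j ∈ Finset.range t, (Nat.choose (k - j) (t - j) : ℤ) * α j) :
    ∀ t ≤ k, 0 ≤ α t := by
  rcases Nat.eq_zero_or_pos k with rfl | hk0
  · intro t ht
    rw [Nat.le_zero.1 ht, hα0]
    positivity
  obtain ⟨part, hpart⟩ := exists_intervalPartition_of_le_stanleyDepth hne hk0 hk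
  obtain ⟨γ, hγ⟩ := part.isIntervalCombination hpart
  suffices h : ∀ t ≤ k, α t = γ t from fun t ht => by rw [h t ht]; positivity
  intro t
  induction t using Nat.strong_induction_on with
  | _ t ih =>
    intro ht
    have hβ : Set.ncard {σ ∈ P | σ.card = t} = _ := hγ t ht
    rcases Nat.eq_zero_or_pos t with rfl | ht0
    · simpa [hα0] using hβ
    · rw [Finset.sum_range_succ, Nat.sub_self, Nat.choose_zero_right, one_mul] at hβ
      have hα : ∑ j ∈ Finset.range t, ((k - j).choose (t - j) : ℤ) * α j =
          ∑ j ∈ Finset.range t, ((k - j).choose (t - j) : ℤ) * γ j :=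
        Finset.sum_congr rfl fun j hj => by
          have hjt := Finset.mem_range.1 hj
          rw [ih j hjt (hjt.le.trans ht)]
      rw [hαt t ht0 ht, hβ, hα]
      push_cast
      ring
end

section
/- For n = 7, the Stanley depth of the family P of cyclically independent subsets of [7] equals 2. (Equivalently, sdepth(S/J_7) = 2 for the edge ideal J_7 of the 7-cycle.) -/
/-- The alternating sum of `(-1) ^ |σ|` over a nondegenerate interval `[F, G]` vanishes. -/
theorem sum_Icc_neg_one_pow_card {α : Type*} [DecidableEq α] {F G : Finset α} (h : F ⊂ G) :
    ∑ σ ∈ Finset.Icc F G, (-1 : ℤ) ^ σ.card = 0 := by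
  rw [Finset.Icc_eq_image_powerset h.1, Finset.sum_image]
  · have hcard : ∀ τ ∈ (G \ F).powerset,
        (-1 : ℤ) ^ (F ∪ τ).card = (-1) ^ F.card * (-1) ^ τ.card := fun τ hτ => by
      rw [Finset.card_union_of_disjoint, pow_add]
      exact Finset.disjoint_sdiff.mono_right (Finset.mem_powerset.1 hτ)
    rw [Finset.sum_congr rfl hcard, ← Finset.mul_sum,
      Finset.sum_powerset_neg_one_pow_card_of_nonempty (Finset.sdiff_nonempty.2 h.2), mul_zero]
  · intro a ha b hb hab
    have hdisj : ∀ τ ∈ (G \ F).powerset, Disjoint F τ := fun τ hτ =>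
      Finset.disjoint_sdiff.mono_right (Finset.mem_powerset.1 hτ)
    rw [← Finset.union_sdiff_cancel_left (hdisj a ha), ← Finset.union_sdiff_cancel_left (hdisj b hb)]
    exact congrArg (· \ F) hab

/-- The alternating sum of `(-1) ^ |σ|` over an interval with upper end of odd size
is nonpositive. -/
theorem sum_Icc_neg_one_pow_card_nonpos {α : Type*} [DecidableEq α] {F G : Finset α}
    (h : F ⊆ G) (hG : Odd G.card) : ∑ σ ∈ Finset.Icc F G, (-1 : ℤ) ^ σ.card ≤ 0 := by
  rcases h.eq_or_ssubset with rfl | h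
  · simp [hG.neg_one_pow]
  · exact (sum_Icc_neg_one_pow_card h).le

/-- The cyclically independent subsets of `[7]`, as a finset. -/
def cyclicIndepSeven : Finset (Finset ℕ) :=
  (Finset.Icc 1 7).powerset.filter fun σ =>
    (∀ i ∈ Finset.Icc 1 6, ¬(i ∈ σ ∧ i + 1 ∈ σ)) ∧ ¬(1 ∈ σ ∧ 7 ∈ σ)

theorem mem_cyclicIndepSeven {σ : Finset ℕ} : σ ∈ cyclicIndepSeven ↔ CyclicIndep 7 σ := by
  simp [cyclicIndepSeven, CyclicIndep, -not_and]

theorem card_le_three_of_mem_cyclicIndepSeven : ∀ σ ∈ cyclicIndepSeven, σ.card ≤ 3 := by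
  decide +kernel

theorem sum_cyclicIndepSeven : ∑ σ ∈ cyclicIndepSeven, (-1 : ℤ) ^ σ.card = 1 := by
  decide +kernel

/-- Lower ends of a partition of the cyclically independent subsets of `[7]`. -/
def lowerSeven : Fin 14 → Finset ℕ :=
  ![∅, {2}, {4}, {6}, {5}, {7}, {1, 4}, {1, 5}, {2, 5}, {2, 6}, {3, 6}, {3, 7}, {4, 7}, {3, 5}]

/-- Upper ends of a partition of the cyclically independent subsets of `[7]`. -/
def upperSeven : Fin 14 → Finset ℕ :=
  ![{1, 3}, {2, 4}, {4, 6}, {1, 6}, {5, 7}, {2, 7}, {1, 4, 6}, {1, 3, 5}, {2, 5, 7}, {2, 4, 6},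
    {1, 3, 6}, {3, 5, 7}, {2, 4, 7}, {3, 5}]

theorem upperSeven_subset : ∀ i, upperSeven i ⊆ Finset.Icc 1 7 := by decide +kernel

theorem mem_cyclicIndepSeven_iff_exists : ∀ σ ∈ (Finset.Icc 1 7).powerset,
    (σ ∈ cyclicIndepSeven ↔ ∃ i, lowerSeven i ⊆ σ ∧ σ ⊆ upperSeven i) := by
  decide +kernel

theorem eq_of_lowerSeven_subset_upperSeven :
    ∀ i j, lowerSeven i ⊆ upperSeven j → lowerSeven j ⊆ upperSeven i → i = j := by
  decide +kernel

/-- A partition of the cyclically independent subsets of `[7]` of sdepth `2`. -/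
def partitionSeven : IntervalPartition 7 {σ : Finset ℕ | CyclicIndep 7 σ} where
  r := 14
  F := lowerSeven
  G := upperSeven
  le := by decide +kernel
  sub := upperSeven_subset
  disj i j hij := Finset.disjoint_left.2 fun σ hi hj => by
    rw [Finset.mem_Icc] at hi hj
    exact hij (eq_of_lowerSeven_subset_upperSeven i j (hi.1.trans hj.2) (hj.1.trans hi.2))
  cover σ := by
    simp only [Set.mem_ofPred_eq, ← mem_cyclicIndepSeven, Finset.mem_Icc]
    by_cases hσ : σ ∈ (Finset.Icc 1 7).powerset
    · exact mem_cyclicIndepSeven_iff_exists σ hσ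
    · refine iff_of_false (fun h => hσ (Finset.mem_filter.1 h).1) ?_
      rintro ⟨i, -, hi⟩
      exact hσ (Finset.mem_powerset.2 (hi.trans (upperSeven_subset i)))

theorem exists_card_upper_le_two
    (part : IntervalPartition 7 {σ : Finset ℕ | CyclicIndep 7 σ}) :
    ∃ i, (part.G i).card ≤ 2 := by
  by_contra! h
  have hunion : cyclicIndepSeven =
      Finset.univ.biUnion fun i => Finset.Icc (part.F i) (part.G i) := by
    ext σ
    simpa [mem_cyclicIndepSeven] using part.cover σ
  have hodd : ∀ i, Odd (part.G i).card := fun i => by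
    have hmem : part.G i ∈ cyclicIndepSeven := mem_cyclicIndepSeven.2
      ((part.cover _).2 ⟨i, Finset.right_mem_Icc.2 (part.le i)⟩)
    rw [(card_le_three_of_mem_cyclicIndepSeven _ hmem).antisymm (h i)]
    decide
  have hsum := sum_cyclicIndepSeven
  rw [hunion, Finset.sum_biUnion fun i _ j _ hij => part.disj i j hij] at hsum
  have hnonpos := Finset.sum_nonpos fun i (_ : i ∈ Finset.univ) =>
    sum_Icc_neg_one_pow_card_nonpos (part.le i) (hodd i)
  omega

/-- The Stanley depth of the family of cyclically independent
subsets of `[7]` equals `2`, i.e. `sdepth(S/J_7) = 2`. -/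
theorem stmt_15 :
    stanleyDepth 7 {σ : Finset ℕ | CyclicIndep 7 σ} = 2 := by
  refine IsGreatest.csSup_eq ⟨⟨partitionSeven, ?_⟩, ?_⟩
  · change ∀ i, 2 ≤ (upperSeven i).card
    decide +kernel
  · rintro k ⟨part, hk⟩
    obtain ⟨i, hi⟩ := exists_card_upper_le_two part
    exact (hk i).trans hi
end

section
/- For n ≥ 3, the Stanley depth of the family P_{I_n} = {σ ⊆ [n] : {i, i+1} ⊆ σ for some 1 ≤ i ≤ n−1} is at least n − ⌊(n−1)/2⌋, and the Stanley depth of the family P_{J_n} = {σ ⊆ [n] : {i, i+1} ⊆ σ for some 1 ≤ i ≤ n−1, or {1,n} ⊆ σ} is at least n − ⌊n/2⌋. (By Herzog–Vladoiu–Zheng these are the characteristic posets of the edge ideals I_n of the n-line and J_n of the n-cycle, so sdepth(I_n) ≥ 1 + (n−1)/2 and sdepth(J_n) ≥ n/2.) -/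
/-- `P` is a finite disjoint union of intervals `[F, G]` with `G ⊆ V` and `d ≤ |G|`. -/
def HasPartition (V : Finset ℕ) (d : ℕ) (P : Set (Finset ℕ)) : Prop :=
  ∃ T : Finset (Finset ℕ × Finset ℕ),
    (∀ p ∈ T, p.1 ⊆ p.2 ∧ p.2 ⊆ V ∧ d ≤ p.2.card) ∧
    (∀ p ∈ T, ∀ q ∈ T, p ≠ q → Disjoint (Finset.Icc p.1 p.2) (Finset.Icc q.1 q.2)) ∧
    ∀ σ, σ ∈ P ↔ ∃ p ∈ T, σ ∈ Finset.Icc p.1 p.2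

namespace HasPartition

variable {V : Finset ℕ} {d : ℕ} {P Q : Set (Finset ℕ)}

theorem empty : HasPartition V d ∅ := ⟨∅, by simp⟩

theorem Icc {F G : Finset ℕ} (hFG : F ⊆ G) (hG : G ⊆ V) (hd : d ≤ G.card) :
    HasPartition V d (Set.Icc F G) :=
  ⟨{(F, G)}, by simp [hFG, hG, hd], by simp, by simp⟩

theorem union (hP : HasPartition V d P) (hQ : HasPartition V d Q) (hPQ : Disjoint P Q) :
    HasPartition V d (P ∪ Q) := by
  obtain ⟨S, hS, hSd, hSc⟩ := hP
  obtain ⟨T, hT, hTd, hTc⟩ := hQ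
  have key : ∀ p ∈ S, ∀ q ∈ T, Disjoint (Finset.Icc p.1 p.2) (Finset.Icc q.1 q.2) :=
    fun p hp q hq => Finset.disjoint_left.2 fun σ h1 h2 =>
      Set.disjoint_left.1 hPQ ((hSc σ).2 ⟨p, hp, h1⟩) ((hTc σ).2 ⟨q, hq, h2⟩)
  refine ⟨S ∪ T, ?_, ?_, ?_⟩
  · intro p hp
    exact (Finset.mem_union.1 hp).elim (hS p) (hT p)
  · intro p hp q hq hne
    rcases Finset.mem_union.1 hp with hp | hp <;> rcases Finset.mem_union.1 hq with hq | hq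
    · exact hSd p hp q hq hne
    · exact key p hp q hq
    · exact (key q hq p hp).symm
    · exact hTd p hp q hq hne
  · intro σ
    simp only [Set.mem_union, hSc, hTc, Finset.mem_union, or_and_right, exists_or]

theorem mono_ground {W : Finset ℕ} (hVW : V ⊆ W) (hP : HasPartition V d P) :
    HasPartition W d P := by
  obtain ⟨T, hT, h⟩ := hP
  exact ⟨T, fun p hp => ⟨(hT p hp).1, (hT p hp).2.1.trans hVW, (hT p hp).2.2⟩, h⟩

theorem le_stanleyDepth {n : ℕ} (hP : HasPartition (Finset.Icc 1 n) d P) (hne : P.Nonempty) :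
    d ≤ stanleyDepth n P := by
  obtain ⟨T, hT, hTd, hTc⟩ := hP
  refine le_csSup ⟨n, ?_⟩ ?_
  · rintro k ⟨part, hk⟩
    obtain ⟨σ, hσ⟩ := hne
    obtain ⟨i, -⟩ := (part.cover σ).1 hσ
    exact (hk i).trans (by simpa using Finset.card_le_card (part.sub i))
  · let e := T.equivFin.symm
    refine ⟨⟨T.card, fun i => (e i).1.1, fun i => (e i).1.2, fun i => (hT _ (e i).2).1,
      fun i => (hT _ (e i).2).2.1, fun i j hij => hTd _ (e i).2 _ (e j).2 fun h =>
        hij (e.injective (Subtype.ext h)), fun σ => ?_⟩, fun i => (hT _ (e i).2).2.2⟩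
    rw [hTc]
    constructor
    · rintro ⟨p, hp, h⟩
      exact ⟨e.symm ⟨p, hp⟩, by simpa using h⟩
    · rintro ⟨i, h⟩
      exact ⟨_, (e i).2, h⟩

end HasPartition

/-- The sets `σ ⊆ V` that contain `W` and contain no member of the list `R`. -/
def avoiding (V W : Finset ℕ) (R : List (Finset ℕ)) : Set (Finset ℕ) :=
  {σ | W ⊆ σ ∧ σ ⊆ V ∧ ∀ r ∈ R, ¬ r ⊆ σ}

theorem hasPartition_avoiding {d : ℕ} (R : List (Finset ℕ)) (V W : Finset ℕ)
    (hd : d + R.length ≤ V.card) : HasPartition V d (avoiding V W R) := by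
  induction hk : (V \ W).card using Nat.strong_induction_on generalizing R V W with
  | _ k ih =>
  subst hk
  by_cases hWV : W ⊆ V
  swap
  · convert HasPartition.empty using 1
    ext σ
    simp only [avoiding, Set.mem_ofPred_eq, Set.mem_empty_iff_false, iff_false]
    exact fun h => hWV (h.1.trans h.2.1)
  induction R with
  | nil =>
    convert HasPartition.Icc hWV subset_rfl (by simpa using hd) using 1
    ext σ
    simp [avoiding]
  | cons r R ihR =>
    rw [List.length_cons] at hd
    by_cases hrW : r ⊆ W
    · convert HasPartition.empty using 1
      ext σ
      simp only [avoiding, Set.mem_ofPred_eq, Set.mem_empty_iff_false, iff_false]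
      exact fun h => h.2.2 r (by simp) (hrW.trans h.1)
    obtain ⟨e, her, heW⟩ := Finset.not_subset.1 hrW
    by_cases heV : e ∈ V
    swap
    · convert ihR (by omega) using 1
      ext σ
      simp only [avoiding, Set.mem_ofPred_eq, List.forall_mem_cons]
      exact ⟨fun h => ⟨h.1, h.2.1, h.2.2.2⟩,
        fun h => ⟨h.1, h.2.1, fun hr => heV (h.2.1 (hr her)), h.2.2⟩⟩
    have h1 : HasPartition V d (avoiding (V.erase e) W R) := by
      refine (ih _ ?_ R (V.erase e) W ?_ rfl).mono_ground (Finset.erase_subset _ _)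
      · refine Finset.card_lt_card (Finset.ssubset_iff_of_subset ?_ |>.2 ⟨e, ?_, ?_⟩)
        · exact Finset.sdiff_subset_sdiff (Finset.erase_subset _ _) subset_rfl
        · simp [heV, heW]
        · simp
      · rw [Finset.card_erase_of_mem heV]
        omega
    have h2 : HasPartition V d (avoiding V (insert e W) (r :: R)) := by
      refine ih _ ?_ (r :: R) V (insert e W) (by simpa using hd) rfl
      refine Finset.card_lt_card (Finset.ssubset_iff_of_subset ?_ |>.2 ⟨e, ?_, ?_⟩)
      · exact Finset.sdiff_subset_sdiff subset_rfl (Finset.subset_insert _ _)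
      · simp [heV, heW]
      · simp
    convert h1.union h2 ?_ using 1
    · ext σ
      simp only [avoiding, Set.mem_ofPred_eq, Set.mem_union, List.forall_mem_cons,
        Finset.insert_subset_iff, Finset.subset_erase]
      have : e ∉ σ → ¬ r ⊆ σ := fun h hr => h (hr her)
      tauto
    · refine Set.disjoint_left.2 fun σ hσ hσ' => ?_
      exact (Finset.subset_erase.1 hσ.2.1).2 (hσ'.1 (Finset.mem_insert_self _ _))

/-- The parity (`true` for even) of the largest `i < m` with `v i ⊆ σ`, and `s` if there is
no such `i`. -/
def lastParity (v : ℕ → Finset ℕ) (s : Bool) (σ : Finset ℕ) : ℕ → Bool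
  | 0 => s
  | m + 1 => if v m ⊆ σ then decide (Even m) else lastParity v s σ m

/-- When the sets with `lastParity v s σ m = e` are partitioned, for at least this many of the
indices `i < m` no avoidance condition on `v i` is imposed. -/
def retained (s e : Bool) (m : ℕ) : ℕ :=
  if e then (m + 1) / 2 else m / 2 + if s then 1 else 0

theorem hasPartition_lastParity {d : ℕ} (V : Finset ℕ) (v : ℕ → Finset ℕ) (s : Bool) (m : ℕ)
    (e : Bool) (W : Finset ℕ) (R : List (Finset ℕ))
    (hd : d + R.length + m ≤ V.card + retained s e m) :
    HasPartition V d {σ ∈ avoiding V W R | lastParity v s σ m = e} := by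
  induction m generalizing e W R with
  | zero =>
    by_cases hse : s = e
    · have : d + R.length ≤ V.card := by
        subst hse
        cases s <;> simpa [retained] using hd
      simpa [lastParity, hse] using hasPartition_avoiding R V W this
    · simpa [lastParity, hse] using HasPartition.empty
  | succ m ih =>
    by_cases he : decide (Even m) = e
    · have hr : ∀ e', retained s e (m + 1) ≤ retained s e' m + 1 := by
        intro e'
        subst he
        by_cases hm : Even m <;> cases s <;> cases e' <;> simp [retained, hm] <;> grind
      have h1 := ih e W R (by have := hr e; omega)
      have h2 := ih (!e) (W ∪ v m) R (by have := hr (!e); omega)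
      convert h1.union h2 ?_ using 1
      · ext σ
        simp only [avoiding, lastParity, Set.mem_ofPred_eq, Set.mem_union, Finset.union_subset_iff,
          he]
        by_cases hv : v m ⊆ σ <;> cases e <;> cases lastParity v s σ m <;> simp [hv]
      · refine Set.disjoint_left.2 fun σ hσ hσ' => ?_
        simpa [hσ.2] using hσ'.2
    · have hr : retained s e (m + 1) ≤ retained s e m := by
        by_cases hm : Even m <;> cases s <;> cases e <;> simp [retained, hm] at he ⊢ <;> grind
      convert ih e W (v m :: R) (by rw [List.length_cons]; omega) using 1
      ext σ
      simp only [avoiding, lastParity, Set.mem_ofPred_eq, List.forall_mem_cons]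
      by_cases hv : v m ⊆ σ <;> simp [hv, he]

theorem exists_subset_iff_lastParity (v : ℕ → Finset ℕ) (σ : Finset ℕ) (m : ℕ) :
    (∃ i < m, v i ⊆ σ) ↔ lastParity v false σ m = true ∨ lastParity v true σ m = false := by
  induction m with
  | zero => simp [lastParity]
  | succ m ih =>
    by_cases hv : v m ⊆ σ
    · refine iff_of_true ⟨m, by omega, hv⟩ ?_
      by_cases hm : Even m <;> simp [lastParity, hv, hm]
    · simp only [lastParity, hv, if_false, ← ih, Nat.lt_succ_iff_lt_or_eq]
      grind

theorem lastParity_true_of_lastParity_false (v : ℕ → Finset ℕ) (σ : Finset ℕ) (m : ℕ)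
    (h : lastParity v false σ m = true) : lastParity v true σ m = true := by
  induction m with
  | zero => simp [lastParity]
  | succ m ih => grind [lastParity]

/-- The sets containing one of `m` given sets have Stanley depth at least `|V| - ⌊m / 2⌋`. -/
theorem hasPartition_generated (V : Finset ℕ) (v : ℕ → Finset ℕ) (m : ℕ) (hm : m ≤ V.card) :
    HasPartition V (V.card - m / 2) {σ | σ ⊆ V ∧ ∃ i < m, v i ⊆ σ} := by
  have h1 := hasPartition_lastParity (d := V.card - m / 2) V v false m true ∅ []
    (by simp [retained]; omega)
  have h2 := hasPartition_lastParity (d := V.card - m / 2) V v true m false ∅ []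
    (by simp [retained]; omega)
  convert h1.union h2 ?_ using 1
  · ext σ
    simp [avoiding, exists_subset_iff_lastParity, and_or_left]
  · refine Set.disjoint_left.2 fun σ hσ hσ' => ?_
    simpa [lastParity_true_of_lastParity_false v σ m hσ.2] using hσ'.2

/-- For `n ≥ 3`, the Stanley depth of the characteristic poset of
the edge ideal `I_n` of the `n`-line is at least `n - ⌊(n-1)/2⌋`, and that of the
edge ideal `J_n` of the `n`-cycle is at least `n - ⌊n/2⌋`. -/
theorem stmt_16 (n : ℕ) (hn : 3 ≤ n) :
    n - (n - 1) / 2 ≤ stanleyDepth n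
        {σ : Finset ℕ | σ ⊆ Finset.Icc 1 n ∧
          ∃ i : ℕ, 1 ≤ i ∧ i ≤ n - 1 ∧ i ∈ σ ∧ i + 1 ∈ σ} ∧
      n - n / 2 ≤ stanleyDepth n
        {σ : Finset ℕ | σ ⊆ Finset.Icc 1 n ∧
          ((∃ i : ℕ, 1 ≤ i ∧ i ≤ n - 1 ∧ i ∈ σ ∧ i + 1 ∈ σ) ∨ (1 ∈ σ ∧ n ∈ σ))} := by
  constructor
  · have h := hasPartition_generated (Finset.Icc 1 n) (fun i => {i + 1, i + 2}) (n - 1) (by simp)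
    rw [Nat.card_Icc, Nat.add_sub_cancel] at h
    convert h.le_stanleyDepth ⟨{1, 2}, by grind, 0, by omega, by simp⟩ using 2
    ext σ
    simp only [Set.mem_ofPred_eq, Finset.insert_subset_iff, Finset.singleton_subset_iff]
    refine and_congr_right fun _ => ⟨?_, ?_⟩
    · rintro ⟨i, h1, h2, h3, h4⟩
      exact ⟨i - 1, by omega, by grind⟩
    · rintro ⟨i, h1, h2, h3⟩
      exact ⟨i + 1, by omega, by omega, h2, h3⟩
  · have h := hasPartition_generated (Finset.Icc 1 n)
      (fun i => if i = n - 1 then {1, n} else {i + 1, i + 2}) n (by simp)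
    rw [Nat.card_Icc, Nat.add_sub_cancel] at h
    convert h.le_stanleyDepth ⟨{1, n}, by grind, n - 1, by omega, by simp⟩ using 2
    ext σ
    simp only [Set.mem_ofPred_eq]
    refine and_congr_right fun _ => ⟨?_, ?_⟩
    · rintro (⟨i, h1, h2, h3, h4⟩ | h)
      · exact ⟨i - 1, by omega, by grind⟩
      · exact ⟨n - 1, by omega, by grind⟩
    · rintro ⟨i, h1, h2⟩
      by_cases hi : i = n - 1
      · exact Or.inr (by grind)
      · exact Or.inl ⟨i + 1, by grind⟩
end

section
/- Let K be a field, n ≥ 6, S = K[x_1,…,x_n], I_n = (x_1x_2, …, x_{n−1}x_n) and J_n = I_n + (x_nx_1). A monomial u ∈ S satisfies u ∈ J_n and u ∉ I_n if and only if u = x_1^α x_n^β w for some integers α, β ≥ 1 and a monomial w in the variables x_3, …, x_{n−2} only, such that w is not divisible by x_i x_{i+1} for any 3 ≤ i ≤ n−3. -/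
open MvPolynomial

section EdgeIdeal

variable {σ R : Type*} [CommSemiring R]

theorem MvPolynomial.X_mul_X_eq_monomial (a b : σ) :
    (X a * X b : MvPolynomial σ R) =
      monomial (Finsupp.single a 1 + Finsupp.single b 1) 1 := by
  simp [X, monomial_mul]

theorem Finsupp.single_add_single_le_iff {a b : σ} (hab : a ≠ b) (d : σ →₀ ℕ) :
    Finsupp.single a 1 + Finsupp.single b 1 ≤ d ↔ d a ≠ 0 ∧ d b ≠ 0 := by
  classical
  constructor
  · intro h
    have ha := h a
    have hb := h b
    simp [hab, hab.symm] at ha hb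
    omega
  · rintro ⟨ha, hb⟩ j
    simp only [Finsupp.add_apply, Finsupp.single_apply]
    split_ifs with h₁ h₂ h₂
    · exact absurd (h₁.trans h₂.symm) hab
    · subst h₁; omega
    · subst h₂; omega
    · omega

theorem MvPolynomial.X_mul_X_dvd_monomial_one_iff [Nontrivial R] {a b : σ} (hab : a ≠ b)
    (d : σ →₀ ℕ) :
    (X a * X b : MvPolynomial σ R) ∣ monomial d 1 ↔ d a ≠ 0 ∧ d b ≠ 0 := by
  rw [X_mul_X_eq_monomial, monomial_dvd_monomial, ← Finsupp.single_add_single_le_iff hab]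
  simp

/-- A monomial lies in the edge ideal of a loopless set `T` of edges iff both endpoints of
some edge occur in it. -/
theorem MvPolynomial.monomial_one_mem_span_X_mul_X_iff [Nontrivial R] {T : Set (σ × σ)}
    (hT : ∀ t ∈ T, t.1 ≠ t.2) (d : σ →₀ ℕ) :
    monomial d (1 : R) ∈ Ideal.span ((fun t : σ × σ => X t.1 * X t.2) '' T) ↔
      ∃ t ∈ T, d t.1 ≠ 0 ∧ d t.2 ≠ 0 := by
  classical
  have himage : (fun t : σ × σ => (X t.1 * X t.2 : MvPolynomial σ R)) '' T =
      (fun s => monomial s (1 : R)) ''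
        ((fun t : σ × σ => Finsupp.single t.1 1 + Finsupp.single t.2 1) '' T) := by
    rw [Set.image_image]
    exact Set.image_congr fun t _ => X_mul_X_eq_monomial t.1 t.2
  rw [himage, mem_ideal_span_monomial_image, support_monomial, if_neg one_ne_zero]
  simp only [Finset.mem_singleton, forall_eq, Set.exists_mem_image]
  exact exists_congr fun t => and_congr_right fun ht =>
    Finsupp.single_add_single_le_iff (hT t ht) d

end EdgeIdeal

theorem MvPolynomial.monomial_one_mem_pathIdeal_iff {K : Type*} [Field K] {n : ℕ}
    (d : Fin n →₀ ℕ) :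
    monomial d (1 : K) ∈ Ideal.span
        {p : MvPolynomial (Fin n) K |
          ∃ i : ℕ, ∃ h : i + 1 < n, p = X ⟨i, Nat.lt_of_succ_lt h⟩ * X ⟨i + 1, h⟩} ↔
      ∃ i : ℕ, ∃ h : i + 1 < n, d ⟨i, Nat.lt_of_succ_lt h⟩ ≠ 0 ∧ d ⟨i + 1, h⟩ ≠ 0 := by
  have key := monomial_one_mem_span_X_mul_X_iff (R := K)
    (T := {t : Fin n × Fin n | ∃ i : ℕ, ∃ h : i + 1 < n, t = (⟨i, Nat.lt_of_succ_lt h⟩, ⟨i + 1, h⟩)})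
    (by rintro t ⟨i, h, rfl⟩; simp) d
  convert key using 1
  · congr! 2
    ext p
    constructor
    · rintro ⟨i, h, rfl⟩
      exact ⟨_, ⟨i, h, rfl⟩, rfl⟩
    · rintro ⟨_, ⟨i, h, rfl⟩, rfl⟩
      exact ⟨i, h, rfl⟩
  · constructor
    · rintro ⟨i, h, hd⟩
      exact ⟨_, ⟨i, h, rfl⟩, hd⟩
    · rintro ⟨_, ⟨i, h, rfl⟩, hd⟩
      exact ⟨i, h, hd⟩

theorem MvPolynomial.monomial_one_mem_cycleIdeal_iff {K : Type*} [Field K] {n : ℕ}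
    (h0 : 0 < n) (hl : n - 1 < n) (hne : n - 1 ≠ 0) (d : Fin n →₀ ℕ) :
    monomial d (1 : K) ∈ Ideal.span
        ({p : MvPolynomial (Fin n) K |
            ∃ i : ℕ, ∃ h : i + 1 < n, p = X ⟨i, Nat.lt_of_succ_lt h⟩ * X ⟨i + 1, h⟩} ∪
          {X ⟨n - 1, hl⟩ * X ⟨0, h0⟩}) ↔
      (∃ i : ℕ, ∃ h : i + 1 < n, d ⟨i, Nat.lt_of_succ_lt h⟩ ≠ 0 ∧ d ⟨i + 1, h⟩ ≠ 0) ∨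
        (d ⟨n - 1, hl⟩ ≠ 0 ∧ d ⟨0, h0⟩ ≠ 0) := by
  have key := monomial_one_mem_span_X_mul_X_iff (R := K)
    (T := {t : Fin n × Fin n | ∃ i : ℕ, ∃ h : i + 1 < n, t = (⟨i, Nat.lt_of_succ_lt h⟩, ⟨i + 1, h⟩)} ∪
      {(⟨n - 1, hl⟩, ⟨0, h0⟩)})
    (by
      rintro t (⟨i, h, rfl⟩ | rfl)
      · simp
      · exact Fin.ne_of_val_ne hne) d
  convert key using 1
  · congr! 2
    ext p
    constructor
    · rintro (⟨i, h, rfl⟩ | rfl)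
      · exact ⟨_, Or.inl ⟨i, h, rfl⟩, rfl⟩
      · exact ⟨_, Or.inr rfl, rfl⟩
    · rintro ⟨_, ⟨i, h, rfl⟩ | rfl, rfl⟩
      · exact Or.inl ⟨i, h, rfl⟩
      · exact Or.inr rfl
  · constructor
    · rintro (⟨i, h, hd⟩ | hd)
      · exact ⟨_, Or.inl ⟨i, h, rfl⟩, hd⟩
      · exact ⟨_, Or.inr rfl, hd⟩
    · rintro ⟨_, ⟨i, h, rfl⟩ | rfl, hd⟩
      · exact Or.inl ⟨i, h, hd⟩
      · exact Or.inr hd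

/-- For a field `K`, `n ≥ 6`, `S = K[x_1,…,x_n]` (realized as
`MvPolynomial (Fin n) K` with `x_j = X ⟨j-1, _⟩`),
`I_n = (x_1x_2, …, x_{n-1}x_n)` and `J_n = I_n + (x_nx_1)`:
a monomial `u ∈ S` satisfies `u ∈ J_n` and `u ∉ I_n` if and only if
`u = x_1^α x_n^β w` for some `α, β ≥ 1` and a monomial `w` in the variables
`x_3, …, x_{n-2}` only, such that `w` is not divisible by `x_i x_{i+1}` for any
`3 ≤ i ≤ n-3`. -/
theorem stmt_18 (K : Type*) [Field K] (n : ℕ) (hn : 6 ≤ n)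
    (u : MvPolynomial (Fin n) K)
    (hu : ∃ d : Fin n →₀ ℕ, u = monomial d (1 : K)) :
    (u ∈ Ideal.span
          ({p : MvPolynomial (Fin n) K |
              ∃ i : ℕ, ∃ h : i + 1 < n, p = X ⟨i, by omega⟩ * X ⟨i + 1, h⟩} ∪
            {X ⟨n - 1, by omega⟩ * X ⟨0, by omega⟩}) ∧
        u ∉ Ideal.span
          {p : MvPolynomial (Fin n) K |
            ∃ i : ℕ, ∃ h : i + 1 < n, p = X ⟨i, by omega⟩ * X ⟨i + 1, h⟩}) ↔
      ∃ α β : ℕ, 1 ≤ α ∧ 1 ≤ β ∧ ∃ e : Fin n →₀ ℕ,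
        (∀ j ∈ e.support, 2 ≤ (j : ℕ) ∧ (j : ℕ) ≤ n - 3) ∧
        (∀ i : ℕ, ∀ h1 : 2 ≤ i, ∀ h2 : i ≤ n - 4,
          ¬((X ⟨i, by omega⟩ * X ⟨i + 1, by omega⟩ : MvPolynomial (Fin n) K) ∣
              monomial e (1 : K))) ∧
        u = X ⟨0, by omega⟩ ^ α * X ⟨n - 1, by omega⟩ ^ β * monomial e (1 : K) := by
  classical
  obtain ⟨d, rfl⟩ := hu
  have h0 : 0 < n := by omega
  have hl : n - 1 < n := by omega
  rw [monomial_one_mem_cycleIdeal_iff h0 hl (by omega), monomial_one_mem_pathIdeal_iff]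
  have hprod : ∀ (α β : ℕ) (e : Fin n →₀ ℕ),
      (X ⟨0, h0⟩ ^ α * X ⟨n - 1, hl⟩ ^ β * monomial e (1 : K) : MvPolynomial (Fin n) K) =
        monomial (Finsupp.single ⟨0, h0⟩ α + Finsupp.single ⟨n - 1, hl⟩ β + e) 1 := by
    intro α β e
    simp [X_pow_eq_monomial, monomial_mul]
  have hdvd : ∀ (e : Fin n →₀ ℕ) (i : ℕ) (h : i + 1 < n),
      (X ⟨i, by omega⟩ * X ⟨i + 1, h⟩ : MvPolynomial (Fin n) K) ∣ monomial e (1 : K) ↔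
        e ⟨i, by omega⟩ ≠ 0 ∧ e ⟨i + 1, h⟩ ≠ 0 := fun e i h =>
    X_mul_X_dvd_monomial_one_iff (by simp) e
  constructor
  · rintro ⟨hJ, hI⟩
    obtain ⟨hlast, hfirst⟩ := hJ.resolve_left hI
    push Not at hI
    refine ⟨d ⟨0, h0⟩, d ⟨n - 1, hl⟩, Nat.one_le_iff_ne_zero.2 hfirst,
      Nat.one_le_iff_ne_zero.2 hlast, (d.erase ⟨0, h0⟩).erase ⟨n - 1, hl⟩, ?_, ?_, ?_⟩
    · rintro ⟨j, hj⟩ hmem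
      simp only [Finsupp.support_erase, Finset.mem_erase, ne_eq, Fin.mk.injEq,
        Finsupp.mem_support_iff] at hmem
      obtain ⟨hjl, hj0, hdj⟩ := hmem
      have hj1 : j ≠ 1 := by
        rintro rfl
        exact hdj (hI 0 hj hfirst)
      have hjpen : j ≠ n - 2 := by
        rintro rfl
        have hpen := hI (n - 2) (by omega) hdj
        simp only [show n - 2 + 1 = n - 1 by omega] at hpen
        exact hlast hpen
      simp only
      omega
    · intro i h1 h2
      rw [hdvd _ i (by omega)]
      rintro ⟨hi, hi'⟩
      rw [Finsupp.erase_ne (by simp only [ne_eq, Fin.mk.injEq]; omega),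
        Finsupp.erase_ne (by simp only [ne_eq, Fin.mk.injEq]; omega)] at hi hi'
      exact hi' (hI i (by omega) hi)
    · rw [hprod]
      congr 1
      have hlast_erase : d ⟨n - 1, hl⟩ = d.erase ⟨0, h0⟩ ⟨n - 1, hl⟩ :=
        (Finsupp.erase_ne (by simp only [ne_eq, Fin.mk.injEq]; omega)).symm
      rw [add_assoc, hlast_erase, Finsupp.single_add_erase, Finsupp.single_add_erase]
  · rintro ⟨α, β, hα, hβ, e, hsupp, hnd, hu⟩
    rw [hprod] at hu
    obtain rfl := monomial_left_injective (one_ne_zero : (1 : K) ≠ 0) hu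
    have he : ∀ (j : ℕ) (hj : j < n), j < 2 ∨ n - 3 < j → e ⟨j, hj⟩ = 0 := by
      intro j hj hout
      by_contra hne
      have := hsupp ⟨j, hj⟩ (Finsupp.mem_support_iff.2 hne)
      simp only at this
      omega
    simp only [Finsupp.add_apply, Finsupp.single_apply, Fin.mk.injEq]
    refine ⟨Or.inr ⟨by rw [if_pos trivial]; omega, by rw [if_pos trivial]; omega⟩, ?_⟩
    rintro ⟨i, h, hi, hi'⟩
    by_cases hmid : 2 ≤ i ∧ i ≤ n - 4
    · rw [if_neg (by omega), if_neg (by omega)] at hi hi'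
      refine hnd i hmid.1 hmid.2 ((hdvd e i h).2 ?_)
      simpa using And.intro hi hi'
    · by_cases hlow : i < 2
      · have := he i (by omega) (Or.inl hlow)
        have := he (i + 1) h
        split_ifs at hi hi' <;> omega
      · have := he (i + 1) h (Or.inr (by omega))
        have := he i (by omega)
        split_ifs at hi hi' <;> omega
end
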